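/- Let n ≥ 3 and let φ, f, S, X_0, X_m and Φ_0^m be as described in the context. Let m ≥ 2, let ñ be an integer with 1 ≤ ñ ≤ n−1, let T be a simple-ñ-od graph with branch point s_0, and suppose α : X_m → T and β : T → X_0 are simplicial maps such that α is surjective, β ∘ α = Φ_0^m, and β(s_0) = v_0. Then there exist an integer ñ_0 with 1 ≤ ñ_0 ≤ ñ, a simple-ñ_0-od graph T̃ with branch point s̃_0, and simplicial maps α̃ : X_m → T̃ and β̃ : T̃ → X_0 such that β̃ ∘ α̃ = Φ_0^m, β̃(s̃_0) = v_0, and whenever x, y, z are distinct vertices of X_m with x adjacent to y, y adjacent to z, and α̃(y) = s̃_0, then Φ_0^m(x) = v_{n−1} or Φ_0^m(z) = v_{n−1}. -/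

import Mathlib

/-! ## Graphs (geometric realizations of finite connected 1-complexes) -/

/-- The data of a graph structure on a space `G`: a finite vertex set and
finitely many parametrized edges. -/
structure GraphData (G : Type*) where
  verts : Finset G
  nE : ℕ
  edge : Fin nE → ℝ → G

namespace GraphData

variable {G : Type*}

/-- Two vertices are adjacent if they are joined by an edge. -/
def Adj (Γ : GraphData G) (v w : G) : Prop :=
  ∃ e, ({Γ.edge e 0, Γ.edge e 1} : Set G) = {v, w}

/-- The axioms making `Γ` an actual graph (a finite connected one-dimensional
simplicial complex realized in `G`): each edge is an arc (parametrized by `[0,1]`)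
joining two distinct vertices, open edges avoid the vertices, the edges cover `G`,
two distinct edges meet only in vertices, and an edge is determined by its
endpoints. -/
def IsGraph [TopologicalSpace G] (Γ : GraphData G) : Prop :=
  (∀ e, ContinuousOn (Γ.edge e) (Set.Icc 0 1)) ∧
  (∀ e, Set.InjOn (Γ.edge e) (Set.Icc 0 1)) ∧
  (∀ e, Γ.edge e 0 ∈ Γ.verts) ∧
  (∀ e, Γ.edge e 1 ∈ Γ.verts) ∧
  (∀ e, Γ.edge e 0 ≠ Γ.edge e 1) ∧
  (∀ e, ∀ t ∈ Set.Ioo (0:ℝ) 1, Γ.edge e t ∉ (Γ.verts : Set G)) ∧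
  (⋃ e, Γ.edge e '' Set.Icc 0 1) = Set.univ ∧
  (∀ e e', e ≠ e' →
    (Γ.edge e '' Set.Icc 0 1) ∩ (Γ.edge e' '' Set.Icc 0 1) ⊆ (Γ.verts : Set G)) ∧
  (∀ e e', ({Γ.edge e 0, Γ.edge e 1} : Set G) = {Γ.edge e' 0, Γ.edge e' 1} → e = e')

end GraphData

/-- A simplicial map between graphs: continuous, vertices to vertices, and each
edge is mapped either onto a vertex or, affinely with respect to the fixed
parametrizations, onto an edge. -/
def IsSimplicialMap {G H : Type*} [TopologicalSpace G] [TopologicalSpace H]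
    (Γ : GraphData G) (Δ : GraphData H) (φ : G → H) : Prop :=
  Continuous φ ∧ (∀ v ∈ Γ.verts, φ v ∈ Δ.verts) ∧
  ∀ e, (∃ w ∈ Δ.verts, ∀ t ∈ Set.Icc (0:ℝ) 1, φ (Γ.edge e t) = w) ∨
    ∃ e', (∀ t ∈ Set.Icc (0:ℝ) 1, φ (Γ.edge e t) = Δ.edge e' t) ∨
          (∀ t ∈ Set.Icc (0:ℝ) 1, φ (Γ.edge e t) = Δ.edge e' (1 - t))

/-- `Γ` is a simple-`m`-od graph with branch point `t₀` and arms given by the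
vertex paths `⟨t₀, t i 1, …, t i (k i)⟩` (`i < m`): the arms are nondegenerate,
pairwise meet exactly in `t₀`, exhaust the vertices, and two vertices are
adjacent exactly when they are consecutive on an arm. -/
def IsSimpleOdWith {G : Type*} [TopologicalSpace G] (Γ : GraphData G) (m : ℕ) (t₀ : G)
    (k : Fin m → ℕ) (t : Fin m → ℕ → G) : Prop :=
  Γ.IsGraph ∧ (∀ i, 1 ≤ k i) ∧ (∀ i, t i 0 = t₀) ∧
  ((Γ.verts : Set G) = {t₀} ∪ {x | ∃ i j, 1 ≤ j ∧ j ≤ k i ∧ x = t i j}) ∧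
  (∀ i j i' j', 1 ≤ j → j ≤ k i → 1 ≤ j' → j' ≤ k i' → t i j = t i' j' →
    i = i' ∧ j = j') ∧
  (∀ i j, 1 ≤ j → j ≤ k i → t i j ≠ t₀) ∧
  (∀ v w, Γ.Adj v w ↔ ∃ i j, j + 1 ≤ k i ∧ ({v, w} : Set G) = {t i j, t i (j + 1)})

/-- `Γ` is a simple-`m`-od graph with branch point `t₀`. -/
def IsSimpleOdGraphData {G : Type*} [TopologicalSpace G] (Γ : GraphData G) (m : ℕ)
    (t₀ : G) : Prop :=
  ∃ k t, IsSimpleOdWith Γ m t₀ k t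

/-- Composite bonding maps `Φ_i^{i+k} : X (i+k) → X i` of an inverse sequence. -/
def bondIter {X : ℕ → Type*} (Φ : ∀ i, X (i + 1) → X i) (i : ℕ) :
    ∀ k : ℕ, X (i + k) → X i
  | 0 => id
  | k + 1 => fun x => bondIter Φ i k (Φ (i + k) x)

/-- The inverse limit of an inverse sequence of spaces. -/
def InvLimit {X : ℕ → Type*} (Φ : ∀ i, X (i + 1) → X i) : Type _ :=
  {x : ∀ i, X i // ∀ i, Φ i (x (i + 1)) = x i}

instance {X : ℕ → Type*} [∀ i, TopologicalSpace (X i)] (Φ : ∀ i, X (i + 1) → X i) :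
    TopologicalSpace (InvLimit Φ) :=
  instTopologicalSpaceSubtype
/-! ## The simple-`n`-od `S`, the bonding map `φ = nφ`, and the continuum `nK` -/

noncomputable section

/-- Arm-coordinate parametrization of the simple-`n`-od in `ℂ`: the pair `(k, t)`
is sent to the point at (clamped) parameter `t ∈ [0,1]` on the ray in the
direction `e^{2πik/n}`. -/
def embC (n : ℕ) (p : ℕ × ℝ) : ℂ :=
  ((min 1 (max 0 p.2) : ℝ) : ℂ) * Complex.exp (2 * Real.pi * Complex.I * (p.1 : ℂ) / (n : ℂ))

/-- The underlying simple-`n`-od `S ⊆ ℂ`. -/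
def Sset (n : ℕ) : Set ℂ := Set.range (embC n)

/-- The simple-`n`-od `S` as a (compact metric) space. -/
abbrev Sspace (n : ℕ) := ↥(Sset n)

/-- Arm coordinates `(ray index, parameter)` of the vertices `v_0, …, v_{n+2}`
of the graph `X_0`:  `v_0` is the branch point; for `1 ≤ i ≤ n-2`, `v_i` is the tip
of ray `i - 1`; `v_{n-1}` and `v_{n+1}` are the midpoint and tip of ray `n - 2`;
`v_n` and `v_{n+2}` are the midpoint and tip of ray `n - 1`. -/
def vcoord (n i : ℕ) : ℕ × ℝ :=
  if i = 0 then (0, 0)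
  else if i ≤ n - 2 then (i - 1, 1)
  else if i = n - 1 then (n - 2, 1 / 2)
  else if i = n then (n - 1, 1 / 2)
  else if i = n + 1 then (n - 2, 1)
  else (n - 1, 1)

/-- The vertex `v_i` of `X_0` as a point of `S`. -/
def vpt (n i : ℕ) : Sspace n := ⟨embC n (vcoord n i), Set.mem_range_self _⟩

/-- The branch point `v_0` of `S`. -/
def centerPt (n : ℕ) : Sspace n := vpt n 0

/-- Affine interpolation, in arm coordinates, between two adjacent vertices of
`X_0` (they lie on a common ray; if one of them is the branch point, the ray of
the other one is used). -/
def interpC (w w' : ℕ × ℝ) (s : ℝ) : ℕ × ℝ :=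
  (if w.2 = 0 then w'.1 else w.1, (1 - s) * w.2 + s * w'.2)

/-- Arm coordinates of the `φ`-image of the `j`-th vertex of `X_1` (counted from
`v_0` outwards) on the `a`-th arm of `X_1` (`1 ≤ a ≤ n`), following the defining
table of `φ = nφ`:

* arm `a ≤ n - 3` has vertices `v_0, u_a, u_{(n-3)+a}, …, u_{2(n-1)(n-3)+a}, v_a`;
* arm `n - 2` has vertices `v_0, u_{(2n-1)(n-3)+2(n-1)+1}, v_{n-2}`;
* arm `n - 1` has vertices `v_0, u_{(2n-1)(n-3)+2(n-1)+2}, u_{(2n-1)(n-3)+2(n-1)+3},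
  v_{n-1}, v_{n+1}`;
* arm `n` has vertices `v_0, u_{(2n-1)(n-3)+1}, …, u_{(2n-1)(n-3)+2(n-1)}, v_n, v_{n+2}`. -/
def imgCoord (n a j : ℕ) : ℕ × ℝ :=
  if a = n then
    (if j = 0 then vcoord n 0
     else if j ≤ 2 * n - 2 then
       (if j = 1 then vcoord n (n - 1)
        else if j % 2 = 0 then vcoord n 0
        else if j = 3 then vcoord n (n - 2)
        else vcoord n ((j - 3) / 2))
     else if j = 2 * n - 1 then vcoord n n
     else vcoord n (n + 2))
  else if a = n - 1 then
    (if j = 0 then vcoord n 0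
     else if j = 1 then vcoord n (n - 1)
     else if j = 2 then vcoord n 0
     else if j = 3 then vcoord n n
     else vcoord n (n + 2))
  else if a = n - 2 then
    (if j = 0 then vcoord n 0
     else if j = 1 then vcoord n (n - 1)
     else vcoord n (n + 1))
  else
    (if j = 0 then vcoord n 0
     else if j ≤ 2 * n - 1 then
       (if j = 1 then vcoord n (n - 1)
        else if j = 2 * n - 1 then vcoord n n
        else if (j - 1) % 2 = 1 then vcoord n 0
        else vcoord n ((a + (j - 1) / 2 - 2) % (n - 2) + 1))
     else vcoord n (n + 2))

/-- Locating a parameter `t ∈ [0,1]` on arm `a` of the subdivision `X_1`: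
returns the index `j` of the edge of `X_1` containing the point together with the
affine coordinate `s ∈ [0,1]` inside this edge.  The vertices of `X_1` are placed
at: `j/(2n)` (`0 ≤ j ≤ 2n`) on arms `a ≤ n-3`; at `0, 1/2, 1` on arm `n-2`;
at `0, 1/6, 2/6, 3/6, 1` on arm `n-1` (the vertices `v_{n-1}`, `v_{n+1}` sit at
`1/2` and `1`); and at `j/(4n-2)` (`0 ≤ j ≤ 2n-1`) followed by `1` on arm `n`
(the vertices `v_n`, `v_{n+2}` sit at `1/2` and `1`). -/
def segOf (n a : ℕ) (t : ℝ) : ℕ × ℝ :=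
  if a = n then
    (if t ≤ 1 / 2 then
      (min (2 * n - 2) ⌊(4 * (n : ℝ) - 2) * t⌋₊,
        (4 * (n : ℝ) - 2) * t - (min (2 * n - 2) ⌊(4 * (n : ℝ) - 2) * t⌋₊ : ℕ))
     else (2 * n - 1, 2 * t - 1))
  else if a = n - 1 then
    (if t ≤ 1 / 2 then
      (min 2 ⌊6 * t⌋₊, 6 * t - (min 2 ⌊6 * t⌋₊ : ℕ))
     else (3, 2 * t - 1))
  else if a = n - 2 then
    (min 1 ⌊2 * t⌋₊, 2 * t - (min 1 ⌊2 * t⌋₊ : ℕ))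
  else
    (min (2 * n - 1) ⌊2 * (n : ℝ) * t⌋₊,
      2 * (n : ℝ) * t - (min (2 * n - 1) ⌊2 * (n : ℝ) * t⌋₊ : ℕ))

/-- The bonding map `φ` in arm coordinates: a point with arm coordinates `p` lies
on arm `a = p.1 % n + 1` at parameter `t`; it lies in the `j`-th edge of `X_1`
on this arm with affine coordinate `s`, and is mapped to the corresponding affine
combination of the `φ`-images of the endpoints of this edge. -/
def Gmap (n : ℕ) (p : ℕ × ℝ) : ℕ × ℝ :=
  interpC (imgCoord n (p.1 % n + 1) (segOf n (p.1 % n + 1) (min 1 (max 0 p.2))).1)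
    (imgCoord n (p.1 % n + 1) ((segOf n (p.1 % n + 1) (min 1 (max 0 p.2))).1 + 1))
    (segOf n (p.1 % n + 1) (min 1 (max 0 p.2))).2

/-- The piecewise-linear bonding map `f : S → S` induced by `φ`. -/
def fS (n : ℕ) : Sspace n → Sspace n := fun z =>
  ⟨embC n (Gmap n (Function.invFun (embC n) (z : ℂ))), Set.mem_range_self _⟩

/-- The continuum `nK`: the inverse limit of the sequence `S ←f S ←f S ⋯`,
realized inside the countable product `S^ℕ`. -/
abbrev nK (n : ℕ) := {x : ℕ → Sspace n // ∀ k, fS n (x (k + 1)) = x k}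

end

noncomputable section

/-- Arm coordinates of the parametrization of the `e`-th edge of `X_0`
(`0 ≤ e ≤ n+1`): for `e < n-2` the edge is `⟨v_0, v_{e+1}⟩` (a whole ray);
edge `n-2` is `⟨v_0, v_{n-1}⟩`; edge `n-1` is `⟨v_{n-1}, v_{n+1}⟩`;
edge `n` is `⟨v_0, v_n⟩`; edge `n+1` is `⟨v_n, v_{n+2}⟩`. -/
def X0edgeCoord (n e : ℕ) (t : ℝ) : ℕ × ℝ :=
  if e < n - 2 then (e, t)
  else if e = n - 2 then (n - 2, t / 2)
  else if e = n - 1 then (n - 2, (1 + t) / 2)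
  else if e = n then (n - 1, t / 2)
  else (n - 1, (1 + t) / 2)

/-- The graph `X_0`: the simple-`n`-od `S`, with vertex set `{v_0, …, v_{n+2}}`
and the `n + 2` edges listed in `X0edgeCoord`. -/
def X0graph (n : ℕ) : GraphData (Sspace n) :=
  letI := Classical.decEq (Sspace n)
  { verts := (Finset.range (n + 3)).image (vpt n)
    nE := n + 2
    edge := fun e t => ⟨embC n (X0edgeCoord n (e : ℕ) t), Set.mem_range_self _⟩ }

end

/-! ## No factorization of `f^m` through a simple-`N`-od with `N < n`

The hypotheses of the theorem are contradictory: a factorization of `f^m` through a simple-`N`-od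
graph with `N < n`, based at the branch point, induces one of `f^(m-1)`, hence finally one of the
identity of `X_0`, which has `n` legs with distinct labels. -/

namespace NOd

/-- The `r`-th nontrivial label in the cyclic enumeration of `1, …, n - 2` starting from `s`. -/
def sig (n s r : ℕ) : ℕ := if s + r ≤ n - 1 then s + r - 1 else s + r + 1 - n

/-- The starting label of the cyclic enumeration read along the arm `a` of `X_1`. -/
def slot (n a : ℕ) : ℕ := if a = n then n - 2 else a

/-- The label (index of the vertex of `X_0`) of the `φ`-image of the `k`-th vertex on the `a`-th
arm of `X_1`. -/
def lab (n a k : ℕ) : ℕ :=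
  if k = 0 then 0
  else if k = 1 then n - 1
  else if a = n - 2 then n + 1
  else if a = n - 1 then (if k = 2 then 0 else if k = 3 then n else n + 2)
  else if k = 2 * n - 1 then n
  else if 2 * n ≤ k then n + 2
  else if k % 2 = 0 then 0
  else sig n (slot n a) ((k - 1) / 2)

/-- The arms of `X_1` along which `φ` visits all the neighbours of `v_0`. -/
def Long (n a : ℕ) : Prop := (1 ≤ a ∧ a + 3 ≤ n) ∨ a = n

section labels

variable {n a b k k' : ℕ}

lemma lab_zero : lab n a 0 = 0 := by simp [lab]

lemma lab_one : lab n a 1 = n - 1 := by simp [lab]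

lemma Long.slot_mem (hn : 3 ≤ n) (ha : Long n a) : 1 ≤ slot n a ∧ slot n a + 2 ≤ n := by
  unfold Long at ha; unfold slot; split_ifs <;> omega

lemma Long.slot_inj (hn : 3 ≤ n) (ha : Long n a) (hb : Long n b) (h : slot n a = slot n b) :
    a = b := by
  unfold Long at ha hb; unfold slot at h; split_ifs at h <;> omega

lemma lab_long (hn : 3 ≤ n) (ha : Long n a) (h0 : k ≠ 0) (h1 : k ≠ 1) :
    lab n a k = if k = 2 * n - 1 then n else if 2 * n ≤ k then n + 2 else if k % 2 = 0 then 0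
      else sig n (slot n a) ((k - 1) / 2) := by
  have h2 : a ≠ n - 2 := by unfold Long at ha; omega
  have h3 : a ≠ n - 1 := by unfold Long at ha; omega
  unfold lab
  rw [if_neg h0, if_neg h1, if_neg h2, if_neg h3]

lemma lab_even (hn : 3 ≤ n) (ha : Long n a) (hk : k % 2 = 0) (h : k + 2 ≤ 2 * n) :
    lab n a k = 0 := by
  by_cases h0 : k = 0
  · rw [h0, lab_zero]
  rw [lab_long hn ha h0 (by omega), if_neg (by omega), if_neg (by omega), if_pos hk]

lemma lab_odd (hn : 3 ≤ n) (ha : Long n a) (h3 : 3 ≤ k) (hk : k % 2 = 1) (h : k + 3 ≤ 2 * n) :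
    lab n a k = sig n (slot n a) ((k - 1) / 2) := by
  rw [lab_long hn ha (by omega) (by omega), if_neg (by omega), if_neg (by omega),
    if_neg (by omega)]

lemma lab_n (hn : 3 ≤ n) (ha : Long n a) : lab n a (2 * n - 1) = n := by
  rw [lab_long hn ha (by omega) (by omega), if_pos rfl]

lemma lab_n2 (hn : 3 ≤ n) (ha : Long n a) : lab n a (2 * n) = n + 2 := by
  rw [lab_long hn ha (by omega) (by omega), if_neg (by omega), if_pos le_rfl]

lemma sig_mem {s r : ℕ} (hs : 1 ≤ s) (hs' : s + 2 ≤ n) (hr : 1 ≤ r) (hr' : r + 2 ≤ n) :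
    1 ≤ sig n s r ∧ sig n s r ≤ n - 2 := by
  unfold sig; split_ifs <;> omega

lemma sig_inj {s r r' : ℕ} (hs : 1 ≤ s) (hr : 1 ≤ r) (hr' : r + 2 ≤ n)
    (hq : 1 ≤ r') (hq' : r' + 2 ≤ n) (h : sig n s r = sig n s r') : r = r' := by
  unfold sig at h; split_ifs at h <;> omega

lemma lab_mid (hn : 3 ≤ n) (ha : Long n a) (h3 : 3 ≤ k) (hk : k % 2 = 1) (h : k + 3 ≤ 2 * n) :
    1 ≤ lab n a k ∧ lab n a k ≤ n - 2 := by
  rw [lab_odd hn ha h3 hk h]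
  have := ha.slot_mem hn
  exact sig_mem this.1 this.2 (by omega) (by omega)

/-- The possible positions on a long arm. -/
lemma lab_cases (hn : 3 ≤ n) (ha : Long n a) (hk : k ≤ 2 * n) :
    (k % 2 = 0 ∧ k + 2 ≤ 2 * n ∧ lab n a k = 0) ∨ (k = 1 ∧ lab n a k = n - 1) ∨
    (3 ≤ k ∧ k % 2 = 1 ∧ k + 3 ≤ 2 * n ∧ 1 ≤ lab n a k ∧ lab n a k ≤ n - 2) ∨
    (k = 2 * n - 1 ∧ lab n a k = n) ∨ (k = 2 * n ∧ lab n a k = n + 2) := by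
  by_cases h1 : k % 2 = 0
  · by_cases h2 : k = 2 * n
    · subst h2; exact Or.inr (Or.inr (Or.inr (Or.inr ⟨rfl, lab_n2 hn ha⟩)))
    · exact Or.inl ⟨h1, by omega, lab_even hn ha h1 (by omega)⟩
  · by_cases h2 : k = 1
    · subst h2; exact Or.inr (Or.inl ⟨rfl, lab_one⟩)
    by_cases h3 : k = 2 * n - 1
    · subst h3; exact Or.inr (Or.inr (Or.inr (Or.inl ⟨rfl, lab_n hn ha⟩)))
    · exact Or.inr (Or.inr (Or.inl ⟨by omega, by omega, by omega,
        lab_mid hn ha (by omega) (by omega) (by omega)⟩))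

lemma lab_eq_zero (hn : 3 ≤ n) (ha : Long n a) (hk : k ≤ 2 * n) (h : lab n a k = 0) :
    k % 2 = 0 ∧ k + 2 ≤ 2 * n := by
  have := lab_cases hn ha hk
  omega

lemma lab_inj (hn : 3 ≤ n) (ha : Long n a) (hk : k ≤ 2 * n) (hk' : k' ≤ 2 * n)
    (h : lab n a k = lab n a k') (h0 : lab n a k ≠ 0) : k = k' := by
  have c := lab_cases hn ha hk
  have c' := lab_cases hn ha hk'
  by_cases hs : 3 ≤ k ∧ k % 2 = 1 ∧ k + 3 ≤ 2 * n
  · have hs' : 3 ≤ k' ∧ k' % 2 = 1 ∧ k' + 3 ≤ 2 * n := by omega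
    rw [lab_odd hn ha hs.1 hs.2.1 hs.2.2, lab_odd hn ha hs'.1 hs'.2.1 hs'.2.2] at h
    have := ha.slot_mem hn
    have := sig_inj this.1 (by omega) (by omega) (by omega) (by omega) h
    omega
  · omega

lemma lab_three_inj (hn : 3 ≤ n) (ha : Long n a) (hb : Long n b) (h : lab n a 3 = lab n b 3) :
    a = b := by
  by_cases h3 : n = 3
  · unfold Long at ha hb; omega
  rw [lab_odd hn ha le_rfl (by omega) (by omega), lab_odd hn hb le_rfl (by omega) (by omega)] at h
  have sa := ha.slot_mem hn
  have sb := hb.slot_mem hn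
  refine ha.slot_inj hn hb ?_
  unfold sig at h; split_ifs at h <;> omega

lemma lab_last_inj (hn : 3 ≤ n) (ha : Long n a) (hb : Long n b)
    (h : lab n a (2 * n - 3) = lab n b (2 * n - 3)) : a = b := by
  by_cases h3 : n = 3
  · unfold Long at ha hb; omega
  rw [lab_odd hn ha (by omega) (by omega) (by omega),
    lab_odd hn hb (by omega) (by omega) (by omega)] at h
  have sa := ha.slot_mem hn
  have sb := hb.slot_mem hn
  refine ha.slot_inj hn hb ?_
  unfold sig at h; split_ifs at h <;> omega

lemma lab_surj (hn : 3 ≤ n) (ha : Long n a) {c : ℕ} (h1 : 1 ≤ c) (h2 : c ≤ n) :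
    ∃ k, k % 2 = 1 ∧ k + 1 ≤ 2 * n ∧ lab n a k = c := by
  by_cases hc : c = n
  · exact ⟨2 * n - 1, by omega, by omega, (lab_n hn ha).trans hc.symm⟩
  by_cases hc' : c = n - 1
  · exact ⟨1, by omega, by omega, lab_one.trans hc'.symm⟩
  have hs := ha.slot_mem hn
  by_cases h : slot n a ≤ c
  · refine ⟨2 * (c + 1 - slot n a) + 1, by omega, by omega, ?_⟩
    rw [lab_odd hn ha (by omega) (by omega) (by omega), sig]
    split_ifs <;> omega
  · refine ⟨2 * (c + n - 1 - slot n a) + 1, by omega, by omega, ?_⟩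
    rw [lab_odd hn ha (by omega) (by omega) (by omega), sig]
    split_ifs <;> omega

end labels

/-- The edges of `X_0`, described as intervals of indices `k₀ ≤ k ≤ k₁` on the arms of `X_1`. -/
def Rng (n a k₀ k₁ : ℕ) : Prop :=
  (1 ≤ a ∧ a + 3 ≤ n ∧ k₀ = 0 ∧ k₁ = 2 * n) ∨ (a = n - 2 ∧ k₀ = 0 ∧ k₁ = 2) ∨
  (a = n - 1 ∧ k₀ = 0 ∧ k₁ = 3) ∨ (a = n ∧ k₀ = 0 ∧ k₁ = 2 * n - 1) ∨
  (a = n - 1 ∧ k₀ = 3 ∧ k₁ = 4) ∨ (a = n ∧ k₀ = 2 * n - 1 ∧ k₁ = 2 * n)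

/-- Label of the initial vertex of an edge of `X_0`. -/
def srcLab (a k₀ : ℕ) : ℕ := if k₀ = 0 then 0 else a

/-- Label of the final vertex of an edge of `X_0`. -/
def tgtLab (a k₀ : ℕ) : ℕ := if k₀ = 0 then a else a + 2

/-- Adjacency in the spider with `N` infinite legs; all the pairs `(i, 0)` represent the
center. -/
def SAdj {N : ℕ} (p q : Fin N × ℕ) : Prop :=
  (q.2 = p.2 + 1 ∧ (p.2 = 0 ∨ p.1 = q.1)) ∨ (p.2 = q.2 + 1 ∧ (q.2 = 0 ∨ p.1 = q.1))

lemma SAdj.symm {N : ℕ} {p q : Fin N × ℕ} (h : SAdj p q) : SAdj q p := by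
  unfold SAdj at *; tauto

lemma SAdj.ht {N : ℕ} {p q : Fin N × ℕ} (h : SAdj p q) : q.2 = p.2 + 1 ∨ p.2 = q.2 + 1 := by
  unfold SAdj at *; tauto

lemma SAdj.leg {N : ℕ} {p q : Fin N × ℕ} (h : SAdj p q) (hp : 1 ≤ p.2) (hq : 1 ≤ q.2) :
    p.1 = q.1 := by
  unfold SAdj at *; rcases h with ⟨_, h | h⟩ | ⟨_, h | h⟩ <;> first | exact h | omega

/-- A walk in a labelled spider that reads the labels of an edge of `X_0`. -/
structure IsPath {N : ℕ} (n : ℕ) (B : Fin N → ℕ → ℕ) (a k₀ k₁ : ℕ) (w : ℕ → Fin N × ℕ) :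
    Prop where
  rng : Rng n a k₀ k₁
  adj : ∀ k, k₀ ≤ k → k < k₁ → SAdj (w k) (w (k + 1))
  lab : ∀ k, k₀ ≤ k → k ≤ k₁ → B (w k).1 (w k).2 = lab n a k

section paths

variable {N n a b k₀ k₁ k : ℕ} {B : Fin N → ℕ → ℕ} {w : ℕ → Fin N × ℕ}

lemma IsPath.height_pos (hB : ∀ i, B i 0 = 0) (P : IsPath n B a k₀ k₁ w) (h0 : k₀ ≤ k)
    (h1 : k ≤ k₁) (h : NOd.lab n a k ≠ 0) : 1 ≤ (w k).2 := by
  by_contra hc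
  have := P.lab k h0 h1
  rw [show (w k).2 = 0 by omega, hB] at this
  exact h this.symm

/-- Along a long arm the walk can turn around only next to the center. -/
lemma IsPath.no_turn (hn : 3 ≤ n) (hB : ∀ i, B i 0 = 0) (ha : Long n a)
    (P : IsPath n B a 0 k₁ w) (hk : 1 ≤ k) (hk1 : k + 2 ≤ k₁) (hpos : 1 ≤ (w (k + 1)).2) :
    (w k).2 ≠ (w (k + 2)).2 ∨ ((w k).2 = 0 ∧ (w (k + 2)).2 = 0) := by
  by_contra hc
  push Not at hc
  obtain ⟨he, hz⟩ := hc
  have hk₁ : k₁ ≤ 2 * n ∧ 2 * n - 1 ≤ k₁ := by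
    have := P.rng; unfold Rng at this; unfold Long at ha; omega
  have hpk : 1 ≤ (w k).2 := by
    by_contra h0
    exact hz (by omega) (by omega)
  have a1 := P.adj k (by omega) (by omega)
  have a2 := P.adj (k + 1) (by omega) (by omega)
  have l1 := a1.leg hpk hpos
  have l2 := a2.leg hpos (by rw [show k + 1 + 1 = k + 2 from rfl]; omega)
  have hw : w k = w (k + 2) := Prod.ext (l1.trans l2) he
  have hl : NOd.lab n a k = NOd.lab n a (k + 2) := by
    rw [← P.lab k (by omega) (by omega), ← P.lab (k + 2) (by omega) (by omega), hw]
  have hl0 : NOd.lab n a k = 0 := by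
    by_contra h0
    have := lab_inj hn ha (by omega) (by omega) hl h0
    omega
  have e1 := lab_eq_zero hn ha (by omega) hl0
  have e2 := lab_eq_zero hn ha (by omega) (hl ▸ hl0)
  obtain ⟨j, rfl⟩ : ∃ j, k = j + 1 := ⟨k - 1, by omega⟩
  have a0 := P.adj j (by omega) (by omega)
  have a3 := P.adj (j + 3) (by omega) (by omega)
  have inj : ∀ x y, x ≤ 2 * n → y ≤ 2 * n → x % 2 = 1 → NOd.lab n a x = NOd.lab n a y → x = y := by
    intro x y hx hy hx2 hxy
    refine lab_inj hn ha hx hy hxy fun h0 => ?_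
    have := lab_eq_zero hn ha hx h0
    omega
  have nz : ∀ x, x ≤ 2 * n → x % 2 = 1 → NOd.lab n a x ≠ 0 := fun x hx' hx h0 => by
    have := lab_eq_zero hn ha hx' h0
    omega
  have p0 := P.height_pos hB (k := j) (by omega) (by omega) (nz _ (by omega) (by omega))
  have p4 := P.height_pos hB (k := j + 4) (by omega) (by omega) (nz _ (by omega) (by omega))
  have q0 := a0.leg p0 hpk
  have hw' : w (j + 3) = w (j + 1) := hw.symm
  rw [hw'] at a3
  have q4 := a3.leg hpk p4
  have L0 := P.lab j (by omega) (by omega)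
  have L2 := P.lab (j + 2) (by omega) (by omega)
  have L4 := P.lab (j + 4) (by omega) (by omega)
  have h0 := a0.ht
  have h2 := a1.ht
  have h4 := a3.ht
  have l1' : (w (j + 1)).1 = (w (j + 2)).1 := l1
  rw [q0] at L0
  rw [← l1'] at L2
  rw [← q4] at L4
  have d02 : (w j).2 ≠ (w (j + 2)).2 := fun h => by
    rw [h] at L0
    have := inj j (j + 2) (by omega) (by omega) (by omega) (L0.symm.trans L2)
    omega
  have d04 : (w j).2 ≠ (w (j + 4)).2 := fun h => by
    rw [h] at L0
    have := inj j (j + 4) (by omega) (by omega) (by omega) (L0.symm.trans L4)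
    omega
  have d24 : (w (j + 2)).2 ≠ (w (j + 4)).2 := fun h => by
    rw [h] at L2
    have := inj (j + 2) (j + 4) (by omega) (by omega) (by omega) (L2.symm.trans L4)
    omega
  simp only [show j + 1 + 1 = j + 2 from rfl, show j + 3 + 1 = j + 4 from rfl] at *
  omega

lemma IsPath.ascend (hn : 3 ≤ n) (hB : ∀ i, B i 0 = 0) (ha : Long n a)
    (P : IsPath n B a 0 k₁ w) (hk : 1 ≤ k) (hpos : 1 ≤ (w k).2)
    (hs : (w (k + 1)).2 = (w k).2 + 1) (s : ℕ) (hle : k + s ≤ k₁) :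
    w (k + s) = ((w k).1, (w k).2 + s) := by
  suffices H : ∀ s, k + s + 1 ≤ k₁ → w (k + s) = ((w k).1, (w k).2 + s) ∧
      w (k + s + 1) = ((w k).1, (w k).2 + (s + 1)) by
    rcases s with _ | s
    · rfl
    · exact (H s (by omega)).2
  intro s
  induction s with
  | zero =>
    intro h
    refine ⟨rfl, Prod.ext ?_ (by simpa using hs)⟩
    exact ((P.adj k (by omega) (by omega)).leg hpos (by omega)).symm
  | succ s ih =>
    intro h
    obtain ⟨h1, h2⟩ := ih (by omega)
    refine ⟨h2, ?_⟩
    have hA := P.adj (k + s + 1) (by omega) (by omega)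
    have ht := hA.ht
    have h1' : (w (k + s)).2 = (w k).2 + s := by rw [h1]
    have h2' : (w (k + s + 1)).2 = (w k).2 + (s + 1) := by rw [h2]
    have := P.no_turn hn hB ha (k := k + s) (by omega) (by omega) (by omega)
    have e : k + (s + 1) + 1 = k + s + 2 := by ring
    rw [e]
    simp only [show k + s + 1 + 1 = k + s + 2 from rfl] at *
    have h3 : (w (k + s + 2)).2 = (w k).2 + (s + 1 + 1) := by omega
    refine Prod.ext ?_ h3
    rw [← hA.leg (by omega) (by omega), h2]

lemma IsPath.descend (hn : 3 ≤ n) (hB : ∀ i, B i 0 = 0) (ha : Long n a)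
    (P : IsPath n B a 0 k₁ w) (hk : k + 1 ≤ k₁) (hpos : 1 ≤ (w (k + 1)).2)
    (hs : (w k).2 = (w (k + 1)).2 + 1) (s : ℕ) (hle : s ≤ k) :
    w (k + 1 - s) = ((w (k + 1)).1, (w (k + 1)).2 + s) := by
  suffices H : ∀ s, s + 1 ≤ k → w (k + 1 - s) = ((w (k + 1)).1, (w (k + 1)).2 + s) ∧
      w (k - s) = ((w (k + 1)).1, (w (k + 1)).2 + (s + 1)) by
    rcases s with _ | s
    · rfl
    · rw [show k + 1 - (s + 1) = k - s by omega]
      exact (H s hle).2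
  intro s
  induction s with
  | zero =>
    intro h
    refine ⟨rfl, Prod.ext ?_ (by simpa using hs)⟩
    exact (P.adj k (by omega) (by omega)).leg (by omega) hpos
  | succ s ih =>
    intro h
    obtain ⟨h1, h2⟩ := ih (by omega)
    rw [show k + 1 - (s + 1) = k - s by omega]
    refine ⟨h2, ?_⟩
    obtain ⟨j, hj⟩ : ∃ j, k = j + s + 1 := ⟨k - s - 1, by omega⟩
    subst hj
    rw [show j + s + 1 - (s + 1) = j by omega]
    rw [show j + s + 1 + 1 - s = j + 2 by omega] at h1
    rw [show j + s + 1 - s = j + 1 by omega] at h2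
    have hA := P.adj j (by omega) (by omega)
    have ht := hA.ht
    have h1' := congrArg Prod.snd h1
    have h2' := congrArg Prod.snd h2
    simp only at h1' h2'
    have := P.no_turn hn hB ha (k := j) (by omega) (by omega) (by omega)
    refine Prod.ext ?_ (by simp only; omega)
    rw [hA.leg (by omega) (by omega), h2]

end paths

section labels

variable {n a b k k' k₀ k₁ : ℕ}

lemma lab_A : lab n (n - 2) 2 = n + 1 := by simp [lab]

lemma lab_B2 (hn : 3 ≤ n) : lab n (n - 1) 2 = 0 := by
  rw [lab, if_neg (by omega), if_neg (by omega), if_neg (by omega), if_pos rfl]; simp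

lemma lab_B3 (hn : 3 ≤ n) : lab n (n - 1) 3 = n := by
  rw [lab, if_neg (by omega), if_neg (by omega), if_neg (by omega), if_pos rfl]; simp

lemma lab_B4 (hn : 3 ≤ n) : lab n (n - 1) 4 = n + 2 := by
  rw [lab, if_neg (by omega), if_neg (by omega), if_neg (by omega), if_pos rfl]; simp

lemma Rng.cases (hn : 3 ≤ n) (h : Rng n a k₀ k₁) :
    (Long n a ∧ k₁ ≤ 2 * n) ∨ (a = n - 2 ∧ k₁ ≤ 2) ∨ (a = n - 1 ∧ k₁ ≤ 4) := by
  unfold Rng at h; unfold Long; omega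

/-- The possible labels along an arm. -/
lemma Rng.lab_cases (hn : 3 ≤ n) (h : Rng n a k₀ k₁) (hk : k ≤ k₁) :
    (Long n a ∧ ((k % 2 = 0 ∧ k + 2 ≤ 2 * n ∧ lab n a k = 0) ∨ (k = 1 ∧ lab n a k = n - 1) ∨
    (3 ≤ k ∧ k % 2 = 1 ∧ k + 3 ≤ 2 * n ∧ 1 ≤ lab n a k ∧ lab n a k ≤ n - 2) ∨
    (k = 2 * n - 1 ∧ lab n a k = n) ∨ (k = 2 * n ∧ lab n a k = n + 2))) ∨
    (a = n - 2 ∧ ((k = 0 ∧ lab n a k = 0) ∨ (k = 1 ∧ lab n a k = n - 1) ∨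
      (k = 2 ∧ lab n a k = n + 1))) ∨
    (a = n - 1 ∧ ((k = 0 ∧ lab n a k = 0) ∨ (k = 1 ∧ lab n a k = n - 1) ∨
      (k = 2 ∧ lab n a k = 0) ∨ (k = 3 ∧ lab n a k = n) ∨ (k = 4 ∧ lab n a k = n + 2))) := by
  rcases h.cases hn with ⟨h1, h2⟩ | ⟨h1, h2⟩ | ⟨h1, h2⟩
  · exact Or.inl ⟨h1, NOd.lab_cases hn h1 (hk.trans h2)⟩
  · subst h1
    have : k ≤ 2 := hk.trans h2
    refine Or.inr (Or.inl ⟨rfl, ?_⟩)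
    interval_cases k
    · simp [lab_zero]
    · simp [lab_one]
    · simp [lab_A]
  · subst h1
    have : k ≤ 4 := hk.trans h2
    refine Or.inr (Or.inr ⟨rfl, ?_⟩)
    interval_cases k
    · simp [lab_zero]
    · simp [lab_one]
    · simp [lab_B2 hn]
    · simp [lab_B3 hn]
    · simp [lab_B4 hn]

lemma not_long_A (hn : 3 ≤ n) : ¬ Long n (n - 2) := by unfold Long; omega

lemma not_long_B (hn : 3 ≤ n) : ¬ Long n (n - 1) := by unfold Long; omega

/-- The block of labels `n, n + 2` is entered only from `0`. -/
lemma Rng.enter (hn : 3 ≤ n) (h : Rng n a k₀ k₁) {x y : ℕ} (hx : x ≤ k₁) (hy : y ≤ k₁)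
    (hxy : x = y + 1 ∨ y = x + 1) (h1 : lab n a x = n ∨ lab n a x = n + 2)
    (h2 : ¬ (lab n a y = n ∨ lab n a y = n + 2)) :
    x = y + 1 ∧ lab n a x = n ∧ lab n a y = 0 := by
  have A := not_long_A hn
  have B := not_long_B hn
  rcases h.lab_cases hn hx with ⟨hl, cx⟩ | ⟨rfl, cx⟩ | ⟨rfl, cx⟩
  · rcases h.lab_cases hn hy with ⟨-, cy⟩ | ⟨rfl, cy⟩ | ⟨rfl, cy⟩
    · omega
    · exact absurd hl A
    · exact absurd hl B
  · rcases h.lab_cases hn hy with ⟨hl, cy⟩ | ⟨-, cy⟩ | ⟨h', cy⟩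
    · exact absurd hl A
    · omega
    · omega
  · rcases h.lab_cases hn hy with ⟨hl, cy⟩ | ⟨h', cy⟩ | ⟨h', cy⟩
    · exact absurd hl B
    · omega
    · omega

/-- The step from `0` into the block `n, n + 2` starts at one of two indices. -/
lemma Rng.hit (hn : 3 ≤ n) (h : Rng n a k₀ k₁) (hk0 : k₀ ≤ k) (hk : k + 1 ≤ k₁)
    (h1 : lab n a (k + 1) = n) :
    k₀ = 0 ∧ ((Long n a ∧ k + 2 = 2 * n) ∨ (a = n - 1 ∧ k = 2)) := by
  have h3 : k₀ = 0 ∨ (a = n - 1 ∧ k₀ = 3) ∨ (a = n ∧ k₀ = 2 * n - 1) := by unfold Rng at h; omega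
  rcases h.lab_cases hn hk with ⟨hl, cx⟩ | ⟨rfl, cx⟩ | ⟨rfl, cx⟩
  · refine ⟨?_, Or.inl ⟨hl, by omega⟩⟩
    rcases h3 with h3 | ⟨rfl, -⟩ | h3
    · exact h3
    · exact absurd hl (not_long_B hn)
    · omega
  · omega
  · omega

end labels

section paths

variable {N n a a' b b' k₀ k₁ k₀' k₁' k k' : ℕ} {B : Fin N → ℕ → ℕ} {w w' : ℕ → Fin N × ℕ}

lemma IsPath.opp (hB : ∀ i, B i 0 = 0) (P : IsPath n B a k₀ k₁ w) (h0 : k₀ ≤ k)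
    (h1 : k + 2 ≤ k₁) (hl : NOd.lab n a k ≠ 0) (hl2 : NOd.lab n a (k + 2) ≠ NOd.lab n a k)
    (hp : 1 ≤ (w (k + 1)).2) :
    (w k).1 = (w (k + 1)).1 ∧ (w k).2 + (w (k + 2)).2 = 2 * (w (k + 1)).2 := by
  have p0 := P.height_pos hB h0 (by omega) hl
  have a0 := P.adj k h0 (by omega)
  have a1 := P.adj (k + 1) (by omega) (by omega)
  have e0 := a0.leg p0 hp
  refine ⟨e0, ?_⟩
  have t0 := a0.ht
  have t1 := a1.ht
  simp only [show k + 1 + 1 = k + 2 from rfl] at *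
  by_contra hc
  have he : (w (k + 2)).2 = (w k).2 := by omega
  have e1 := a1.leg hp (by omega)
  apply hl2
  rw [← P.lab k h0 (by omega), ← P.lab (k + 2) (by omega) h1, he, ← e1, e0]

/-- The arm is determined by a step into the block `n, n + 2` away from the center. -/
lemma IsPath.exit (hn : 3 ≤ n) (hB : ∀ i, B i 0 = 0) (P : IsPath n B a k₀ k₁ w)
    (P' : IsPath n B a' k₀' k₁' w') (hk0 : k₀ ≤ k) (hk : k + 1 ≤ k₁) (hk0' : k₀' ≤ k')
    (hk' : k' + 1 ≤ k₁') (hl : NOd.lab n a (k + 1) = n) (hl' : NOd.lab n a' (k' + 1) = n)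
    (e0 : w k = w' k') (e1 : (w (k + 1)).2 = (w' (k' + 1)).2) (hp : 1 ≤ (w k).2) : a = a' := by
  have key : ∀ {a k₀ k₁ k : ℕ} {w : ℕ → Fin N × ℕ}, IsPath n B a k₀ k₁ w → k₀ ≤ k → k + 1 ≤ k₁ →
      NOd.lab n a (k + 1) = n → 1 ≤ (w k).2 →
      NOd.lab n a (k - 1) = B (w k).1 (2 * (w k).2 - (w (k + 1)).2) ∧
      ((Long n a ∧ k + 2 = 2 * n) ∨ (a = n - 1 ∧ k = 2)) := by
    intro a k₀ k₁ k w P hk0 hk hl hp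
    obtain ⟨h0, h1⟩ := P.rng.hit hn hk0 hk hl
    refine ⟨?_, h1⟩
    obtain ⟨j, rfl⟩ : ∃ j, k = j + 1 := ⟨k - 1, by omega⟩
    have hj : NOd.lab n a j ≠ 0 ∧ NOd.lab n a j ≠ n := by
      rcases h1 with ⟨h1, h2⟩ | ⟨rfl, h2⟩
      · have := NOd.lab_cases hn h1 (k := j) (by omega)
        omega
      · obtain rfl : j = 1 := by omega
        rw [lab_one]; omega
    obtain ⟨q1, q2⟩ := P.opp hB (k := j) (by omega) hk hj.1 (by rw [hl]; exact hj.2.symm) hp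
    rw [Nat.add_sub_cancel, ← P.lab j (by omega) (by omega), q1]
    congr 1
    simp only [show j + 1 + 1 = j + 2 from rfl] at *
    omega
  obtain ⟨x1, x2⟩ := key P hk0 hk hl hp
  obtain ⟨y1, y2⟩ := key P' hk0' hk' hl' (e0 ▸ hp)
  rw [← e0, ← e1] at y1
  have e := x1.trans y1.symm
  rcases x2 with ⟨L, x2⟩ | ⟨rfl, rfl⟩ <;> rcases y2 with ⟨L', y2⟩ | ⟨rfl, rfl⟩
  · rw [show k - 1 = 2 * n - 3 by omega, show k' - 1 = 2 * n - 3 by omega] at e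
    exact lab_last_inj hn L L' e
  · have := NOd.lab_cases hn L (k := k - 1) (by omega)
    rw [show 2 - 1 = 1 from rfl, lab_one] at e
    omega
  · have := NOd.lab_cases hn L' (k := k' - 1) (by omega)
    rw [show 2 - 1 = 1 from rfl, lab_one] at e
    omega
  · rfl

/-- The labels read outwards along a leg, when a walk leaves height `1` at a middle index. -/
lemma IsPath.outward (hn : 3 ≤ n) (hB : ∀ i, B i 0 = 0) (P : IsPath n B a k₀ k₁ w) {x y : ℕ}
    (hx0 : k₀ ≤ x) (hx : x ≤ k₁) (hy0 : k₀ ≤ y) (hy : y ≤ k₁) (hxy : y = x + 1 ∨ x = y + 1)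
    (hp : (w x).2 = 1) (hq : (w y).2 = 2)
    (hl : 1 ≤ NOd.lab n a x ∧ NOd.lab n a x ≤ n - 2) :
    Long n a ∧ 3 ≤ x ∧ x + 3 ≤ 2 * n ∧
    ((∀ s, x + s ≤ 2 * n - 1 → B (w x).1 (1 + s) = NOd.lab n a (x + s)) ∨
      (∀ s, s < x → B (w x).1 (1 + s) = NOd.lab n a (x - s))) := by
  have c := P.rng.lab_cases hn hx
  have hL : Long n a := by
    rcases c with c | c | c
    · exact c.1
    · omega
    · omega
  have hxr : 3 ≤ x ∧ x + 3 ≤ 2 * n := by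
    rcases c with c | c | c <;> omega
  have hr : k₀ = 0 ∧ 2 * n - 1 ≤ k₁ := by
    have := P.rng; unfold Rng at this; unfold Long at hL; omega
  obtain ⟨rfl, hr⟩ := hr
  refine ⟨hL, hxr.1, hxr.2, ?_⟩
  rcases hxy with rfl | rfl
  · left
    intro s hs
    have := P.ascend hn hB hL (k := x) (by omega) (by omega) (by omega) s (by omega)
    rw [← P.lab (x + s) (by omega) (by omega), this, hp]
  · right
    intro s hs
    have := P.descend hn hB hL (k := y) (by omega) (by omega) (by omega) s (by omega)
    rw [← P.lab (y + 1 - s) (by omega) (by omega), this, hp]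

/-- The arm and the index are determined by a step from height `1` to height `2` starting at a
middle index. -/
lemma IsPath.second (hn : 3 ≤ n) (hB : ∀ i, B i 0 = 0) (P : IsPath n B a k₀ k₁ w)
    (P' : IsPath n B a' k₀' k₁' w') {x y x' y' : ℕ}
    (hx0 : k₀ ≤ x) (hx : x ≤ k₁) (hy0 : k₀ ≤ y) (hy : y ≤ k₁) (hxy : y = x + 1 ∨ x = y + 1)
    (hx0' : k₀' ≤ x') (hx' : x' ≤ k₁') (hy0' : k₀' ≤ y') (hy' : y' ≤ k₁')
    (hxy' : y' = x' + 1 ∨ x' = y' + 1)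
    (hp : (w x).2 = 1) (hq : (w y).2 = 2) (hp' : (w' x').2 = 1) (hq' : (w' y').2 = 2)
    (hleg : (w x).1 = (w' x').1)
    (hl : 1 ≤ NOd.lab n a x ∧ NOd.lab n a x ≤ n - 2) : a = a' ∧ x = x' := by
  have hl' : NOd.lab n a' x' = NOd.lab n a x := by
    rw [← P.lab x hx0 hx, ← P'.lab x' hx0' hx', hp, hp', hleg]
  obtain ⟨L, x1, x2, H⟩ := P.outward hn hB hx0 hx hy0 hy hxy hp hq hl
  obtain ⟨L', x1', x2', H'⟩ := P'.outward hn hB hx0' hx' hy0' hy' hxy' hp' hq' (by omega)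
  rw [← hleg] at H'
  have inj1 : ∀ {a z}, Long n a → z ≤ 2 * n → NOd.lab n a z = n - 1 → z = 1 := by
    intro a z L hz h
    have := NOd.lab_cases hn L hz
    omega
  have inj2 : ∀ {a z}, Long n a → z ≤ 2 * n → NOd.lab n a z = n → z = 2 * n - 1 := by
    intro a z L hz h
    have := NOd.lab_cases hn L hz
    omega
  have up_down : ∀ {a a' x x'} (i : Fin N), Long n a → Long n a' → 3 ≤ x → x + 3 ≤ 2 * n → 3 ≤ x' →
      x' + 3 ≤ 2 * n →
      (∀ s, x + s ≤ 2 * n - 1 → B i (1 + s) = NOd.lab n a (x + s)) →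
      (∀ s, s < x' → B i (1 + s) = NOd.lab n a' (x' - s)) → False := by
    intro a a' x x' i L L' h1 h2 h3 h4 U D
    by_cases h : x + (x' - 1) ≤ 2 * n - 1
    · have e := (U _ h).symm.trans (D _ (by omega))
      rw [show x' - (x' - 1) = 1 by omega, lab_one] at e
      have := inj1 L (by omega) e
      omega
    · have e := (U (2 * n - 1 - x) (by omega)).symm.trans (D _ (by omega))
      rw [show x + (2 * n - 1 - x) = 2 * n - 1 by omega, lab_n hn L] at e
      have := inj2 L' (by omega) e.symm
      omega
  rcases H with U | D <;> rcases H' with U' | D'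
  · have e : x = x' := by
      rcases le_total x x' with h | h
      · have e := (U (2 * n - 1 - x') (by omega)).symm.trans (U' _ (by omega))
        rw [show x' + (2 * n - 1 - x') = 2 * n - 1 by omega, lab_n hn L'] at e
        have := inj2 L (by omega) e
        omega
      · have e := (U (2 * n - 1 - x) (by omega)).symm.trans (U' _ (by omega))
        rw [show x + (2 * n - 1 - x) = 2 * n - 1 by omega, lab_n hn L] at e
        have := inj2 L' (by omega) e.symm
        omega
    subst e
    refine ⟨lab_last_inj hn L L' ?_, rfl⟩
    have e := (U (2 * n - 3 - x) (by omega)).symm.trans (U' _ (by omega))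
    rwa [show x + (2 * n - 3 - x) = 2 * n - 3 by omega] at e
  · exact (up_down _ L L' x1 x2 x1' x2' U D').elim
  · exact (up_down _ L' L x1' x2' x1 x2 U' D).elim
  · have e : x = x' := by
      rcases le_total x x' with h | h
      · have e := (D (x - 1) (by omega)).symm.trans (D' _ (by omega))
        rw [show x - (x - 1) = 1 by omega, lab_one] at e
        have := inj1 L' (by omega) e.symm
        omega
      · have e := (D (x' - 1) (by omega)).symm.trans (D' _ (by omega))
        rw [show x' - (x' - 1) = 1 by omega, lab_one] at e
        have := inj1 L (by omega) e
        omega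
    subst e
    refine ⟨lab_three_inj hn L L' ?_, rfl⟩
    have e := (D (x - 3) (by omega)).symm.trans (D' _ (by omega))
    rwa [show x - (x - 3) = 3 by omega] at e

end paths

/-- A net of walks: every oriented edge of `E` (whose ends carry the labels of an edge of `X_0`)
is realized by a walk in a labelled spider reading the labels of that edge of `X_0`, and all the
edges are connected with each other. -/
structure Net (n : ℕ) {V : Type*} (g : V → ℕ) (E : V → V → Prop) {N : ℕ} (B : Fin N → ℕ → ℕ)
    (A : V → Fin N × ℕ) : Prop where
  zero : ∀ i, B i 0 = 0
  edge : ∀ u v, E u v → ∃ a k₀ k₁ w, IsPath n B a k₀ k₁ w ∧ w k₀ = A u ∧ w k₁ = A v ∧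
    g u = srcLab a k₀ ∧ g v = tgtLab a k₀
  conn : ∀ u v u' v', E u v → E u' v' → Relation.EqvGen E u u'

/-- A walk realizing an edge of a net. -/
structure IsEdgePath (n : ℕ) {V : Type*} (g : V → ℕ) (E : V → V → Prop) {N : ℕ}
    (B : Fin N → ℕ → ℕ) (A : V → Fin N × ℕ) (u v : V) (a k₀ k₁ : ℕ) (w : ℕ → Fin N × ℕ) :
    Prop extends IsPath n B a k₀ k₁ w where
  edge : E u v
  src : w k₀ = A u
  tgt : w k₁ = A v
  src_lab : g u = srcLab a k₀
  tgt_lab : g v = tgtLab a k₀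

/-- The arm of `X_1` ending at (or, for the labels `n - 1` and `n`, containing) the vertex with
a given label. -/
def stArm (n l : ℕ) : ℕ := if l ≤ n then l else l - 2

/-- The index on the arm `stArm n l` of the vertex of `X_0` with label `l`. -/
def stIdx (n l : ℕ) : ℕ :=
  if l = 0 then 0 else if l + 3 ≤ n then 2 * n else if l = n - 2 then 2 else if l = n - 1 then 3
  else if l = n then 2 * n - 1 else if l = n + 1 then 4 else 2 * n

lemma Rng.src {n a k₀ k₁ : ℕ} (hn : 3 ≤ n) (h : Rng n a k₀ k₁) :
    (k₀ = 0 ∧ stIdx n (srcLab a k₀) = 0) ∨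
      (stArm n (srcLab a k₀) = a ∧ stIdx n (srcLab a k₀) = k₀) := by
  unfold stIdx stArm srcLab
  rcases h with h | h | h | h | h | h <;> obtain ⟨h1, h2, h3⟩ := h <;> split_ifs <;> omega

lemma Rng.tgt {n a k₀ k₁ : ℕ} (hn : 3 ≤ n) (h : Rng n a k₀ k₁) :
    stArm n (tgtLab a k₀) = a ∧ stIdx n (tgtLab a k₀) = k₁ := by
  have e : tgtLab a k₀ = if k₀ = 0 then a else a + 2 := rfl
  generalize tgtLab a k₀ = l at e
  unfold stIdx stArm
  unfold Rng at h
  split_ifs at e <;> constructor <;> split_ifs <;> omega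

lemma Rng.lt {n a k₀ k₁ : ℕ} (hn : 3 ≤ n) (h : Rng n a k₀ k₁) : k₀ < k₁ := by
  unfold Rng at h; omega

lemma Rng.le {n a k₀ k₁ : ℕ} (hn : 3 ≤ n) (h : Rng n a k₀ k₁) : k₁ ≤ 2 * n := by
  unfold Rng at h; omega

section net

variable {n : ℕ} {V : Type*} {g : V → ℕ} {E : V → V → Prop} {N : ℕ}
    {B : Fin N → ℕ → ℕ} {A : V → Fin N × ℕ} {u v u' v' : V} {a k₀ k₁ a' k₀' k₁' k k' : ℕ}
    {w w' : ℕ → Fin N × ℕ}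

lemma Net.exists_path (H : Net n g E B A) (h : E u v) :
    ∃ a k₀ k₁ w, IsEdgePath n g E B A u v a k₀ k₁ w := by
  obtain ⟨a, k₀, k₁, w, P, h1, h2, h3, h4⟩ := H.edge u v h
  exact ⟨a, k₀, k₁, w, ⟨P, h, h1, h2, h3, h4⟩⟩

/-- A property of the points of the edge paths that is invariant along each step is constant. -/
lemma Net.const (hn : 3 ≤ n) (H : Net n g E B A) (Q : ℕ → ℕ → Fin N × ℕ → Prop)
    (h0 : ∀ b b' p, B p.1 p.2 = 0 → (Q b 0 p ↔ Q b' 0 p))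
    (hs : ∀ u v b k₀ k₁ w x y, IsEdgePath n g E B A u v b k₀ k₁ w → k₀ ≤ x → x ≤ k₁ → k₀ ≤ y →
      y ≤ k₁ → (y = x + 1 ∨ x = y + 1) → (w y).2 = (w x).2 + 1 → (Q b x (w x) ↔ Q b y (w y)))
    (P : IsEdgePath n g E B A u v a k₀ k₁ w) (P' : IsEdgePath n g E B A u' v' a' k₀' k₁' w')
    (hk0 : k₀ ≤ k) (hk : k ≤ k₁) (hk0' : k₀' ≤ k') (hk' : k' ≤ k₁') :
    Q a k (w k) ↔ Q a' k' (w' k') := by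
  set QV : V → Prop := fun x => Q (stArm n (g x)) (stIdx n (g x)) (A x) with hQV
  have src : ∀ {u v a k₀ k₁ w}, IsEdgePath n g E B A u v a k₀ k₁ w →
      (Q a k₀ (w k₀) ↔ QV u) := by
    intro u v a k₀ k₁ w P
    have hr := P.rng.lt hn
    simp only [hQV, ← P.src, P.src_lab]
    rcases P.rng.src hn with ⟨rfl, e⟩ | ⟨e1, e2⟩
    · rw [e]
      exact h0 _ _ _ (by rw [P.lab 0 le_rfl hr.le, lab_zero])
    · rw [e1, e2]
  have tgt : ∀ {u v a k₀ k₁ w}, IsEdgePath n g E B A u v a k₀ k₁ w →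
      (Q a k₁ (w k₁) ↔ QV v) := by
    intro u v a k₀ k₁ w P
    obtain ⟨e1, e2⟩ := P.rng.tgt hn
    simp only [hQV, ← P.tgt, P.tgt_lab, e1, e2]
  have along : ∀ {u v a k₀ k₁ w}, IsEdgePath n g E B A u v a k₀ k₁ w → ∀ k, k₀ ≤ k → k ≤ k₁ →
      (Q a k (w k) ↔ QV u) := by
    intro u v a k₀ k₁ w P k hk
    induction k, hk using Nat.le_induction with
    | base => exact fun _ => src P
    | succ k hk ih =>
      intro h
      rw [← ih (by omega)]
      rcases (P.adj k hk (by omega)).ht with e | e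
      · exact (hs _ _ _ _ _ _ k (k + 1) P hk (by omega) (by omega) h (Or.inl rfl) e).symm
      · exact hs _ _ _ _ _ _ (k + 1) k P (by omega) h hk (by omega) (Or.inr rfl) e
  have edge : ∀ u v, E u v → (QV u ↔ QV v) := by
    intro u v h
    obtain ⟨a, k₀, k₁, w, P⟩ := H.exists_path h
    rw [← tgt P, along P k₁ (P.rng.lt hn).le le_rfl]
  rw [along P k hk0 hk, along P' k' hk0' hk']
  suffices ∀ x y, Relation.EqvGen E x y → (QV x ↔ QV y) from
    this _ _ (H.conn u v u' v' P.edge P'.edge)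
  intro x y h
  induction h with
  | rel x y h => exact edge x y h
  | refl x => rfl
  | symm x y _ ih => exact ih.symm
  | trans x y z _ _ ih1 ih2 => exact ih1.trans ih2

set_option maxHeartbeats 1000000 in
/-- All the steps from the center into a block `n, n + 2` belong to the same arm, if one of them
belongs to a long arm. -/
lemma Net.center_hit_of_long (hn : 3 ≤ n) (hN : N + 1 ≤ n) (H : Net n g E B A)
    (P : IsEdgePath n g E B A u v a k₀ k₁ w) (P' : IsEdgePath n g E B A u' v' a' k₀' k₁' w')
    (hk0 : k₀ ≤ k) (hk : k + 1 ≤ k₁) (hk0' : k₀' ≤ k') (hk' : k' + 1 ≤ k₁')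
    (hl : lab n a (k + 1) = n) (hc : (w k).2 = 0) (hc' : (w' k').2 = 0) (ha : Long n a) :
    a = a' := by
  have hB := H.zero
  obtain ⟨c, hc1, hcN⟩ : ∃ c ∈ Finset.Icc 1 n, c ∉ Finset.univ.image (fun i => B i 1) := by
    by_contra hcon
    push Not at hcon
    have := Finset.card_le_card (show Finset.Icc 1 n ⊆ _ from hcon)
    have h2 := Finset.card_image_le (s := (Finset.univ : Finset (Fin N))) (f := fun i => B i 1)
    simp at this h2
    omega
  have hmiss : ∀ i, B i 1 ≠ c := fun i h => hcN (Finset.mem_image.2 ⟨i, Finset.mem_univ _, h⟩)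
  rw [Finset.mem_Icc] at hc1
  obtain ⟨κ, hκ1, hκ2, hκ⟩ := lab_surj hn ha hc1.1 hc1.2
  have hit1 : k + 2 = 2 * n := by
    have := P.rng.hit hn hk0 hk hl
    rcases this with ⟨-, h | h⟩
    · exact h.2
    · exact absurd (h.1 ▸ ha) (not_long_B hn)
  have hn1 : B (w (k + 1)).1 1 = n := by
    have h1 := P.lab (k + 1) (by omega) hk
    have h2 := P.height_pos hB (k := k + 1) (by omega) hk (by omega)
    have h3 := (P.adj k hk0 (by omega)).ht
    rw [show (w (k + 1)).2 = 1 by omega] at h1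
    omega
  have hκn : κ + 3 ≤ 2 * n := by
    by_contra hcon
    have : κ = 2 * n - 1 := by omega
    rw [this, lab_n hn ha] at hκ
    exact hmiss _ (hn1.trans hκ)
  set run : Fin N × ℕ → Prop := fun p => ∀ h, 1 ≤ h → h ≤ p.2 → B p.1 h = n ∨ B p.1 h = n + 2
    with hrun
  set cout : Fin N → Prop := fun μ => ∃ k₀ k₁ w k, IsPath n B a k₀ k₁ w ∧ k₀ ≤ k ∧ k + 1 ≤ k₁ ∧
    lab n a (k + 1) = n ∧ (w k).1 = μ ∧ (w (k + 1)).1 = μ ∧ (w k).2 = (w (k + 1)).2 + 1 ∧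
    run (w (k + 1)) ∧ ¬ run (w k) with hcout
  set cin : Fin N → Prop := fun μ => ∃ k₀ k₁ w x y, IsPath n B a k₀ k₁ w ∧ k₀ ≤ x ∧ x ≤ k₁ ∧
    k₀ ≤ y ∧ y ≤ k₁ ∧ (y = x + 1 ∨ x = y + 1) ∧ w x = (μ, 1) ∧ (w y).2 = 2 ∧ κ < x with hcin
  set Q : ℕ → ℕ → Fin N × ℕ → Prop := fun b x p =>
    (p.2 = 0 ∧ b = a ∧ κ < x) ∨
    (1 ≤ p.2 ∧ B p.1 1 = n ∧ ((run p ∧ b = a) ∨ (¬ run p ∧ cout p.1))) ∨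
    (1 ≤ p.2 ∧ 1 ≤ B p.1 1 ∧ B p.1 1 ≤ n - 2 ∧
      ((p.2 = 1 ∧ b = a ∧ κ < x) ∨ (2 ≤ p.2 ∧ cin p.1))) with hQ
  by_contra hne
  have key := H.const hn Q ?_ ?_ P P' hk0 (by omega) hk0' (by omega)
  · have q1 : Q a k (w k) := Or.inl ⟨hc, rfl, by omega⟩
    have q2 := key.1 q1
    simp only [hQ, hc'] at q2
    rcases q2 with q2 | q2 | q2
    · exact hne q2.2.1.symm
    · omega
    · omega
  · intro b b' p hp
    simp only [hQ]
    have r : 1 ≤ p.2 → ¬ run p := by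
      intro h1 h2
      have := h2 p.2 h1 le_rfl
      omega
    have s : p.2 = 1 → B p.1 1 = 0 := fun h => by rw [← h]; exact hp
    constructor
    · rintro (h | ⟨h1, h2, h | h⟩ | ⟨h1, h2, h3, h | h⟩)
      · omega
      · exact absurd h.1 (r h1)
      · exact Or.inr (Or.inl ⟨h1, h2, Or.inr h⟩)
      · have := s h.1; omega
      · exact Or.inr (Or.inr ⟨h1, h2, h3, Or.inr h⟩)
    · rintro (h | ⟨h1, h2, h | h⟩ | ⟨h1, h2, h3, h | h⟩)
      · omega
      · exact absurd h.1 (r h1)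
      · exact Or.inr (Or.inl ⟨h1, h2, Or.inr h⟩)
      · have := s h.1; omega
      · exact Or.inr (Or.inr ⟨h1, h2, h3, Or.inr h⟩)
  · intro u v b l₀ l₁ w x y R hx0 hx hy0 hy hxy ht
    have Lx := R.lab x hx0 hx
    have Ly := R.lab y hy0 hy
    rcases Nat.eq_zero_or_pos (w x).2 with hz | hz
    · have hy1 : (w y).2 = 1 := by omega
      rw [hz, hB] at Lx
      rw [hy1] at Ly
      have Qx : Q b x (w x) ↔ b = a ∧ κ < x := by
        simp only [hQ, hz]
        constructor
        · rintro (h | h | h)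
          · exact h.2
          · omega
          · omega
        · exact fun h => Or.inl ⟨trivial, h⟩
      rw [Qx]
      by_cases hba : b = a
      · subst hba
        have cx := lab_cases hn ha (k := x) (by have := R.rng.le hn; omega)
        have cy := lab_cases hn ha (k := y) (by have := R.rng.le hn; omega)
        have hyκ : y ≠ κ := by
          rintro rfl
          exact hmiss _ (Ly.trans hκ)
        have h1κ : lab n b y = n - 1 → κ ≠ 1 := by
          rintro h rfl
          rw [lab_one] at hκ
          exact hmiss (w y).1 (by omega)
        have ry : lab n b y = n → run (w y) := by
          intro h j h1 h2
          obtain rfl : j = 1 := by omega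
          exact Or.inl (by omega)
        simp only [hQ, hy1, Ly]
        constructor
        · rintro ⟨-, h⟩
          rcases cy with c | c | c | c | c
          · omega
          · have := h1κ c.2; omega
          · exact Or.inr (Or.inr
              ⟨le_rfl, c.2.2.2.1, c.2.2.2.2, Or.inl ⟨trivial, trivial, by omega⟩⟩)
          · exact Or.inr (Or.inl ⟨le_rfl, c.2, Or.inl ⟨ry c.2, trivial⟩⟩)
          · omega
        · rintro (h | ⟨h1, h2, h⟩ | ⟨h1, h2, h3, h | h⟩)
          · omega
          · exact ⟨trivial, by omega⟩
          · exact ⟨trivial, by omega⟩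
          · omega
      · have ry : B (w y).1 1 = n → run (w y) := by
          intro h j h1 h2
          obtain rfl : j = 1 := by omega
          exact Or.inl h
        simp only [hQ, hba, hy1, false_and, and_false, false_iff, false_or]
        rintro (⟨h1, h2, h, -⟩ | h)
        · exact h (ry h2)
        · omega
    · have hleg : (w x).1 = (w y).1 := by
        rcases hxy with rfl | rfl
        · exact (R.adj x hx0 (by omega)).leg hz (by omega)
        · exact ((R.adj y hy0 (by omega)).leg (by omega) hz).symm
      rw [hleg] at Lx
      have e1 : (w x).2 ≠ 0 := by omega
      have e2 : (w y).2 ≠ 0 := by omega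
      have e3 : (w y).2 ≠ 1 := by omega
      have e4 : 2 ≤ (w y).2 := by omega
      have e5 : 1 ≤ (w y).2 := by omega
      have main1 : B (w y).1 1 = n →
          (((run (w x) ∧ b = a) ∨ (¬ run (w x) ∧ cout (w y).1)) ↔
            ((run (w y) ∧ b = a) ∨ (¬ run (w y) ∧ cout (w y).1))) := by
        intro hone
        by_cases rx : run (w x)
        · by_cases ry : run (w y)
          · simp [rx, ry]
          · simp only [rx, ry, true_and, not_true, not_false_iff, false_and, or_false, false_or]
            have lx : lab n b x = n ∨ lab n b x = n + 2 := by
              rw [← Lx, ← hleg]; exact rx _ hz le_rfl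
            have ly : ¬ (lab n b y = n ∨ lab n b y = n + 2) := by
              intro hcon
              apply ry
              intro j j1 j2
              by_cases hj : j = (w y).2
              · rw [hj, Ly]; exact hcon
              · rw [← hleg]; exact rx j j1 (by omega)
            obtain ⟨rfl, f2, f3⟩ := R.rng.enter hn hx hy (by omega) lx ly
            constructor
            · rintro rfl
              exact ⟨l₀, l₁, w, y, R.toIsPath, hy0, hx, f2, rfl, hleg, ht, rx, ry⟩
            · rintro ⟨m₀, m₁, w₂, z, P₂, z0, z1, z2, z3, z4, z5, z6, z7⟩
              have hh : (w₂ z).2 = (w y).2 := by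
                by_contra hcon
                rcases Nat.lt_or_gt_of_ne hcon with hlt | hlt
                · apply z7
                  intro j j1 j2
                  rw [z3, ← hleg]
                  exact rx j j1 (by omega)
                · apply ry
                  intro j j1 j2
                  rw [← z4]
                  exact z6 j j1 (by omega)
              exact R.toIsPath.exit hn hB P₂ hy0 hx z0 z1 f2 z2 (Prod.ext z3.symm hh.symm)
                (by omega) e5
        · have ry : ¬ run (w y) := by
            intro h
            apply rx
            intro j j1 j2
            rw [hleg]
            exact h j j1 (by omega)
          simp [rx, ry]
      have main2 : 1 ≤ B (w y).1 1 → B (w y).1 1 ≤ n - 2 →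
          ((((w x).2 = 1 ∧ b = a ∧ κ < x) ∨ (2 ≤ (w x).2 ∧ cin (w y).1)) ↔ cin (w y).1) := by
        intro hone htwo
        by_cases hx1 : (w x).2 = 1
        · simp only [hx1, true_and, Nat.not_ofNat_le_one, false_and, or_false]
          rw [hx1] at Lx
          constructor
          · rintro ⟨rfl, hκx⟩
            exact ⟨l₀, l₁, w, x, y, R.toIsPath, hx0, hx, hy0, hy, hxy, Prod.ext hleg hx1,
              by omega, hκx⟩
          · rintro ⟨m₀, m₁, w₂, x₂, y₂, P₂, r1, r2, r3, r4, r5, r6, r7, r8⟩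
            obtain ⟨f1, f2⟩ := R.toIsPath.second hn hB P₂ hx0 hx hy0 hy hxy r1 r2 r3 r4 r5 hx1
              (by omega) (by rw [r6]) r7 (by rw [r6, hleg]) (by omega)
            exact ⟨f1, by omega⟩
        · have : 2 ≤ (w x).2 := by omega
          simp [hx1, this]
      have hz' : 1 ≤ (w x).2 := hz
      simp only [hQ, hleg, e1, e2, e3, e4, e5, hz', false_and, true_and, false_or]
      by_cases b1 : B (w y).1 1 = n
      · have b2 : ¬ (B (w y).1 1 ≤ n - 2) := by omega
        simp only [b1, true_and, show ¬ (n ≤ n - 2) by omega, false_and, and_false, or_false]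
        exact main1 b1
      · by_cases b2 : 1 ≤ B (w y).1 1 ∧ B (w y).1 1 ≤ n - 2
        · simp only [b1, false_and, b2.1, b2.2, true_and, false_or]
          exact main2 b2.1 b2.2
        · have b3 : ∀ X : Prop, ¬ (1 ≤ B (w y).1 1 ∧ B (w y).1 1 ≤ n - 2 ∧ X) :=
            fun X h => b2 ⟨h.1, h.2.1⟩
          simp only [b1, false_and, b3]

/-- All the steps from the center into a block `n, n + 2` belong to the same arm. -/
lemma Net.center_hit (hn : 3 ≤ n) (hN : N + 1 ≤ n) (H : Net n g E B A)
    (P : IsEdgePath n g E B A u v a k₀ k₁ w) (P' : IsEdgePath n g E B A u' v' a' k₀' k₁' w')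
    (hk0 : k₀ ≤ k) (hk : k + 1 ≤ k₁) (hk0' : k₀' ≤ k') (hk' : k' + 1 ≤ k₁')
    (hl : lab n a (k + 1) = n) (hl' : lab n a' (k' + 1) = n) (hc : (w k).2 = 0)
    (hc' : (w' k').2 = 0) : a = a' := by
  obtain ⟨-, h | h⟩ := P.rng.hit hn hk0 hk hl
  · exact H.center_hit_of_long hn hN P P' hk0 hk hk0' hk' hl hc hc' h.1
  · obtain ⟨-, h' | h'⟩ := P'.rng.hit hn hk0' hk' hl'
    · exact (H.center_hit_of_long hn hN P' P hk0' hk' hk0 hk hl' hc' hc h'.1).symm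
    · exact h.1.trans h'.1.symm

/-- Two edge paths meeting in a block `n, n + 2` read the same arm. -/
lemma Net.meet (hn : 3 ≤ n) (hN : N + 1 ≤ n) (H : Net n g E B A)
    (P : IsEdgePath n g E B A u v a k₀ k₁ w) (P' : IsEdgePath n g E B A u' v' a' k₀' k₁' w')
    (hk0 : k₀ ≤ k) (hk : k ≤ k₁) (hk0' : k₀' ≤ k') (hk' : k' ≤ k₁')
    (hl : lab n a k = n ∨ lab n a k = n + 2) (he : w k = w' k') : a = a' := by
  have hB := H.zero
  have Lk := P.lab k hk0 hk
  have hpos := P.height_pos hB hk0 hk (by omega)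
  set p := w k with hp
  set run : Fin N × ℕ → Prop := fun q => q.1 = p.1 ∧ ∀ h, min p.2 q.2 ≤ h → h ≤ max p.2 q.2 →
    B p.1 h = n ∨ B p.1 h = n + 2 with hrun
  set cout : Prop := ∃ u v k₀ k₁ w k, IsEdgePath n g E B A u v a k₀ k₁ w ∧ k₀ ≤ k ∧ k + 1 ≤ k₁ ∧
    lab n a (k + 1) = n ∧ p.2 ≤ (w (k + 1)).2 ∧ (w k).1 = p.1 ∧ (w k).2 = (w (k + 1)).2 + 1 ∧
    run (w (k + 1)) ∧ ¬ run (w k) with hcout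
  set cin : Prop := ∃ u v k₀ k₁ w k, IsEdgePath n g E B A u v a k₀ k₁ w ∧ k₀ ≤ k ∧ k + 1 ≤ k₁ ∧
    lab n a (k + 1) = n ∧ (w (k + 1)).2 ≤ p.2 ∧ (w (k + 1)).2 = (w k).2 + 1 ∧
    run (w (k + 1)) ∧ ¬ run (w k) with hcin
  set Q : ℕ → ℕ → Fin N × ℕ → Prop := fun b _ q =>
    (run q ∧ b = a) ∨ (¬ run q ∧ ((q.1 = p.1 ∧ p.2 < q.2) ∧ cout ∨
      ¬ (q.1 = p.1 ∧ p.2 < q.2) ∧ cin)) with hQ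
  have runp : run p := by
    refine ⟨rfl, fun h h1 h2 => ?_⟩
    obtain rfl : h = p.2 := by simp at h1 h2; omega
    omega
  have runB : ∀ q, run q → B q.1 q.2 = n ∨ B q.1 q.2 = n + 2 := by
    rintro q ⟨q1, q2⟩
    rw [q1]
    exact q2 _ (min_le_right _ _) (le_max_right _ _)
  have key := H.const hn Q ?_ ?_ P P' hk0 hk hk0' hk'
  · have q1 : Q a k (w k) := Or.inl ⟨runp, rfl⟩
    have q2 := key.1 q1
    rw [← he] at q2
    rcases q2 with q2 | q2
    · exact q2.2.symm
    · exact absurd runp q2.1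
  · intro b b' q hq
    have : ¬ run q := fun h => by have := runB q h; omega
    simp only [hQ, this, false_and, not_false_iff, true_and]
  · intro u v b l₀ l₁ w x y R hx0 hx hy0 hy hxy ht
    have Lx := R.lab x hx0 hx
    have Ly := R.lab y hy0 hy
    have hleg : 1 ≤ (w x).2 → (w x).1 = (w y).1 := by
      intro hz
      rcases hxy with rfl | rfl
      · exact (R.adj x hx0 (by omega)).leg hz (by omega)
      · exact ((R.adj y hy0 (by omega)).leg (by omega) hz).symm
    have run0 : run (w x) → 1 ≤ (w x).2 := by
      intro h
      by_contra hcon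
      have := runB _ h
      rw [show (w x).2 = 0 by omega, hB] at this
      omega
    have extend : ∀ q r : Fin N × ℕ, run q → r.1 = p.1 → (r.2 = q.2 + 1 ∨ q.2 = r.2 + 1) →
        (B r.1 r.2 = n ∨ B r.1 r.2 = n + 2) → run r := by
      rintro q r ⟨q1, q2⟩ r1 hqr hr
      refine ⟨r1, fun h h1 h2 => ?_⟩
      by_cases hh : h = r.2
      · rw [hh, ← r1]; exact hr
      · exact q2 h (by omega) (by omega)
    have between : ∀ q r : Fin N × ℕ, run q → r.1 = p.1 → min p.2 q.2 ≤ r.2 → r.2 ≤ max p.2 q.2 →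
        run r := by
      rintro q r ⟨q1, q2⟩ r1 h1 h2
      exact ⟨r1, fun h h3 h4 => q2 h (by omega) (by omega)⟩
    by_cases rx : run (w x) <;> by_cases ry : run (w y)
    · simp [hQ, rx, ry]
    · have hz := run0 rx
      have hl := hleg hz
      have hyp : (w y).1 = p.1 := hl ▸ rx.1
      have ly : ¬ (lab n b y = n ∨ lab n b y = n + 2) := by
        intro hcon
        exact ry (extend _ _ rx hyp (Or.inl ht) (by rwa [Ly]))
      have lx : lab n b x = n ∨ lab n b x = n + 2 := by
        rw [← Lx]; exact runB _ rx
      obtain ⟨rfl, f2, f3⟩ := R.rng.enter hn hx hy (by omega) lx ly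
      have hpy : p.2 ≤ (w (y + 1)).2 := by
        by_contra hcon
        exact ry (between _ _ rx hyp (by omega) (by omega))
      simp only [hQ, rx, ry, hyp, true_and, false_and, not_false_iff, not_true, or_false, false_or,
        show p.2 < (w y).2 by omega]
      constructor
      · rintro rfl
        exact ⟨u, v, l₀, l₁, w, y, R, hy0, hx, f2, hpy, hyp, ht, rx, ry⟩
      · rintro ⟨u₂, v₂, m₀, m₁, w₂, z, P₂, z0, z1, z2, z3, z4, z5, z6, z7⟩
        have hh : (w₂ z).2 = (w y).2 := by
          by_contra hcon
          rcases Nat.lt_or_gt_of_ne hcon with hlt | hlt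
          · exact z7 (between _ _ rx z4 (by omega) (by omega))
          · exact ry (between _ _ z6 hyp (by omega) (by omega))
        exact R.toIsPath.exit hn hB P₂.toIsPath hy0 hx z0 z1 f2 z2
          (Prod.ext (hyp.trans z4.symm) hh.symm) (by omega) (by omega)
    · have lx : ¬ (lab n b x = n ∨ lab n b x = n + 2) := by
        intro hcon
        have hz : 1 ≤ (w x).2 := R.height_pos hB hx0 hx (by omega)
        exact rx (extend _ _ ry ((hleg hz).trans ry.1) (Or.inr ht) (by rwa [Lx]))
      have ly : lab n b y = n ∨ lab n b y = n + 2 := by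
        rw [← Ly]; exact runB _ ry
      obtain ⟨rfl, f2, f3⟩ := R.rng.enter hn hy hx (by omega) ly lx
      have hpy : (w (x + 1)).2 ≤ p.2 := by
        by_contra hcon
        by_cases hz : 1 ≤ (w x).2
        · exact rx (between _ _ ry ((hleg hz).trans ry.1) (by omega) (by omega))
        · omega
      simp only [hQ, rx, ry, true_and, false_and, not_false_iff, not_true, or_false, false_or,
        show ¬ (p.2 < (w x).2) by omega, and_false]
      constructor
      · rintro ⟨u₂, v₂, m₀, m₁, w₂, z, P₂, z0, z1, z2, z3, z4, z5, z6⟩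
        have leg2 : 1 ≤ (w₂ z).2 → (w₂ z).1 = p.1 := fun h =>
          ((P₂.adj z z0 (by omega)).leg h (by omega)).trans z5.1
        have hh : (w₂ z).2 = (w x).2 := by
          by_contra hcon
          rcases Nat.lt_or_gt_of_ne hcon with hlt | hlt
          · exact rx (between _ _ z5 ((hleg (by omega)).trans ry.1) (by omega) (by omega))
          · exact z6 (between _ _ ry (leg2 (by omega)) (by omega) (by omega))
        by_cases hz : 1 ≤ (w x).2
        · exact R.toIsPath.exit hn hB P₂.toIsPath hx0 hy z0 z1 f2 z2
            (Prod.ext (((hleg hz).trans ry.1).trans (leg2 (by omega)).symm) hh.symm) (by omega) hz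
        · exact H.center_hit hn hN R P₂ hx0 hy z0 z1 f2 z2 (by omega) (by omega)
      · rintro rfl
        exact ⟨u, v, l₀, l₁, w, x, R, hx0, hy, f2, hpy, ht, ry, rx⟩
    · have : ((w x).1 = p.1 ∧ p.2 < (w x).2) ↔ ((w y).1 = p.1 ∧ p.2 < (w y).2) := by
        constructor
        · rintro ⟨h1, h2⟩
          exact ⟨(hleg (by omega)) ▸ h1, by omega⟩
        · rintro ⟨h1, h2⟩
          have hz : 1 ≤ (w x).2 := by omega
          have hx1 := (hleg hz).trans h1
          refine ⟨hx1, ?_⟩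
          by_contra hcon
          exact rx ((Prod.ext hx1 (by omega) : w x = p) ▸ runp)
      simp only [hQ, rx, ry, false_and, not_false_iff, true_and, false_or, this]

end net

open Classical in
/-- The number of `k ∈ {1, …, h}` satisfying `P`. -/
noncomputable def cnt (P : ℕ → Prop) : ℕ → ℕ
  | 0 => 0
  | h + 1 => cnt P h + if P (h + 1) then 1 else 0

section cnt

variable {P : ℕ → Prop} {h h' k : ℕ}

lemma cnt_mono (P : ℕ → Prop) : Monotone (cnt P) :=
  monotone_nat_of_le_succ fun h => by simp [cnt]

lemma cnt_succ_of (hP : P (h + 1)) : cnt P (h + 1) = cnt P h + 1 := by simp [cnt, hP]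

lemma cnt_succ_of_not (hP : ¬ P (h + 1)) : cnt P (h + 1) = cnt P h := by simp [cnt, hP]

lemma cnt_lt (hk : h < k) (hk' : k ≤ h') (hP : P k) : cnt P h < cnt P h' := by
  obtain ⟨j, rfl⟩ : ∃ j, k = j + 1 := ⟨k - 1, by omega⟩
  have h1 := cnt_mono P (show h ≤ j by omega)
  have h2 := cnt_mono P hk'
  rw [cnt_succ_of hP] at h2
  omega

lemma cnt_eq (hh : h ≤ h') (hP : ∀ k, h < k → k ≤ h' → ¬ P k) : cnt P h = cnt P h' := by
  induction h', hh using Nat.le_induction with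
  | base => rfl
  | succ j hj ih =>
    rw [cnt_succ_of_not (hP _ (by omega) le_rfl)]
    exact ih fun k h1 h2 => hP k h1 (by omega)

lemma lt_of_cnt_lt (hc : cnt P h < cnt P h') : h < h' := by
  by_contra hcon
  exact absurd (cnt_mono P (not_lt.1 hcon)) (by omega)

end cnt

/-- The labelled graph `(E, g)` maps simplicially to a labelled spider with `N` legs. -/
def Factors (N : ℕ) {V : Type*} (g : V → ℕ) (E : V → V → Prop) : Prop :=
  ∃ (B : Fin N → ℕ → ℕ) (A : V → Fin N × ℕ), (∀ i, B i 0 = 0) ∧ ∀ u v, E u v →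
    B (A u).1 (A u).2 = g u ∧ B (A v).1 (A v).2 = g v ∧ SAdj (A u) (A v)

/-- The vertex `y` is an end of an edge. -/
def IsEnd {V : Type*} (E : V → V → Prop) (y : V) : Prop := ∃ u v, E u v ∧ (y = u ∨ y = v)

/-- The position `p` lies below `q` in a spider, and no end of an edge lies between them. -/
def Below {V : Type*} (E : V → V → Prop) {N : ℕ} (A : V → Fin N × ℕ) (p q : Fin N × ℕ) : Prop :=
  p.2 < q.2 ∧ (p.2 = 0 ∨ p.1 = q.1) ∧ ∀ y, IsEnd E y → (A y).1 = q.1 → p.2 < (A y).2 →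
    q.2 ≤ (A y).2

/-- Removing the unoccupied vertices of a spider turns a placement whose edges join consecutive
occupied positions into a simplicial map. -/
lemma factors_of_below {V : Type*} {E : V → V → Prop} {g : V → ℕ} {N : ℕ} (A : V → Fin N × ℕ)
    (h0 : ∀ y, IsEnd E y → (A y).2 = 0 → g y = 0)
    (h1 : ∀ y z, IsEnd E y → IsEnd E z → A y = A z → g y = g z)
    (h2 : ∀ u v, E u v → Below E A (A u) (A v) ∨ Below E A (A v) (A u)) : Factors N g E := by
  classical
  set occ : Fin N → ℕ → Prop := fun i h => ∃ y, IsEnd E y ∧ A y = (i, h) with hocc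
  set D : V → Fin N × ℕ := fun y => ((A y).1, cnt (occ (A y).1) (A y).2) with hD
  set C : Fin N → ℕ → ℕ := fun i j => if hj : ∃ y, IsEnd E y ∧ D y = (i, j) ∧ j ≠ 0 then g hj.choose
    else 0 with hC
  have occA : ∀ y, IsEnd E y → occ (A y).1 (A y).2 := fun y hy => ⟨y, hy, rfl⟩
  have D0 : ∀ y, IsEnd E y → ((D y).2 = 0 ↔ (A y).2 = 0) := by
    intro y hy
    constructor
    · intro h
      by_contra hcon
      have := cnt_lt (h := 0) (Nat.pos_of_ne_zero hcon) le_rfl (occA y hy)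
      simp only [hD] at h
      omega
    · intro h
      simp only [hD, h, cnt]
  have lbl : ∀ y, IsEnd E y → C (D y).1 (D y).2 = g y := by
    intro y hy
    by_cases hy0 : (D y).2 = 0
    · rw [h0 y hy ((D0 y hy).1 hy0)]
      simp only [hC]
      rw [dif_neg]
      rintro ⟨z, -, -, hz⟩
      exact hz hy0
    · have hex : ∃ z, IsEnd E z ∧ D z = ((D y).1, (D y).2) ∧ (D y).2 ≠ 0 := ⟨y, hy, rfl, hy0⟩
      simp only [hC]
      rw [dif_pos hex]
      obtain ⟨z1, z2, -⟩ := hex.choose_spec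
      set z := hex.choose
      refine h1 z y z1 hy ?_
      have e1 : (D z).1 = (D y).1 := by rw [z2]
      have e2 : (D z).2 = (D y).2 := by rw [z2]
      simp only [hD] at e1 e2
      refine Prod.ext e1 ?_
      rw [e1] at e2
      have o1 := occA z z1
      rw [e1] at o1
      have o2 := occA y hy
      rcases lt_trichotomy (A z).2 (A y).2 with h | h | h
      · have := cnt_lt h le_rfl o2; omega
      · exact h
      · have := cnt_lt h le_rfl o1; omega
  have adj : ∀ u v, IsEnd E u → IsEnd E v → Below E A (A u) (A v) → SAdj (D u) (D v) := by
    rintro u v hu hv ⟨b1, b2, b3⟩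
    have key : cnt (occ (A v).1) (A v).2 = cnt (occ (A v).1) (A u).2 + 1 := by
      obtain ⟨j, hj⟩ : ∃ j, (A v).2 = j + 1 := ⟨(A v).2 - 1, by omega⟩
      rw [hj, cnt_succ_of (hj ▸ occA v hv)]
      congr 1
      refine (cnt_eq (by omega) ?_).symm
      rintro k k1 k2 ⟨y, hy, e⟩
      have := b3 y hy (by rw [e]) (by rw [e]; exact k1)
      rw [e] at this
      simp only at this
      omega
    rcases b2 with hz | hleg
    · have : (D u).2 = 0 := (D0 u hu).2 hz
      refine Or.inl ⟨?_, Or.inl this⟩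
      rw [this]
      simp only [hD, key, hz, cnt]
    · refine Or.inl ⟨?_, Or.inr hleg⟩
      simp only [hD, hleg]
      exact key
  refine ⟨C, D, ?_, ?_⟩
  · intro i
    simp only [hC]
    rw [dif_neg]
    rintro ⟨z, -, -, hz⟩
    exact hz rfl
  · intro u v huv
    have hu : IsEnd E u := ⟨u, v, huv, Or.inl rfl⟩
    have hv : IsEnd E v := ⟨u, v, huv, Or.inr rfl⟩
    refine ⟨lbl u hu, lbl v hv, ?_⟩
    rcases h2 u v huv with h | h
    · exact adj u v hu hv h
    · exact (adj v u hv hu h).symm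

/-- The vertices of a leg with labels `b` that are neither on a fold `0, n - 1, 0` nor below the
first label `n - 1` on a leg starting with labels in `{0, …, n - 2}`. -/
def Kept (n : ℕ) (b : ℕ → ℕ) (h : ℕ) : Prop :=
  ¬ (b h = n - 1 ∧ b (h - 1) = 0 ∧ b (h + 1) = 0) ∧
  ¬ (2 ≤ h ∧ b h = 0 ∧ b (h - 1) = n - 1 ∧ b (h - 2) = 0) ∧
  ¬ ∃ k, h ≤ k ∧ b (k + 1) = n - 1 ∧ ∀ j ≤ k, b j ≤ n - 2

/-- The position of a vertex of a labelled spider after contracting the vertices that are not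
kept. -/
noncomputable def contract {N : ℕ} (n : ℕ) (B : Fin N → ℕ → ℕ) (p : Fin N × ℕ) : Fin N × ℕ :=
  (p.1, cnt (Kept n (B p.1)) p.2)

section kept

variable {n : ℕ} {b : ℕ → ℕ} {h : ℕ}

lemma kept_of_le (hn : 3 ≤ n) (hb : n ≤ b h) : Kept n b h := by
  refine ⟨by omega, by omega, ?_⟩
  rintro ⟨k, hk, -, h2⟩
  have := h2 h hk
  omega

lemma kept_of_above (hn : 3 ≤ n) {j : ℕ} (hj : j ≤ h) (hb : n ≤ b j)
    (h1 : ¬ (b h = n - 1 ∧ b (h - 1) = 0)) (h2 : ¬ (b h = 0 ∧ b (h - 1) = n - 1)) :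
    Kept n b h := by
  refine ⟨by tauto, by tauto, ?_⟩
  rintro ⟨k, hk, -, h2⟩
  have := h2 j (by omega)
  omega

lemma exists_kept (hn : 3 ≤ n) (hb : n ≤ b h) : ∀ h', h < h' → b h' = 0 →
    ∃ k, h < k ∧ k ≤ h' ∧ Kept n b k := by
  intro h'
  induction h' using Nat.strong_induction_on with
  | _ h' ih =>
    intro hlt hz
    by_cases hcut : 2 ≤ h' ∧ b h' = 0 ∧ b (h' - 1) = n - 1 ∧ b (h' - 2) = 0
    · obtain ⟨c1, c2, c3, c4⟩ := hcut
      have : h ≠ h' - 1 := by rintro rfl; omega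
      have : h ≠ h' - 2 := by rintro rfl; omega
      obtain ⟨k, k1, k2, k3⟩ := ih (h' - 2) (by omega) (by omega) c4
      exact ⟨k, k1, by omega, k3⟩
    · refine ⟨h', hlt, le_rfl, by omega, hcut, ?_⟩
      rintro ⟨k, hk, -, h2⟩
      have := h2 h (by omega)
      omega

end kept

section contract

variable {n N : ℕ} {B : Fin N → ℕ → ℕ}

/-- The two ends of a fold `0, n - 1, 0` are identified by the contraction. -/
lemma contract_fold (hn : 3 ≤ n) (hB : ∀ i, B i 0 = 0) {x m z : Fin N × ℕ} (hx : SAdj x m)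
    (hz : SAdj m z) (lx : B x.1 x.2 = 0) (lm : B m.1 m.2 = n - 1) (lz : B z.1 z.2 = 0) :
    (contract n B x).2 = (contract n B z).2 ∧ ((contract n B x).2 = 0 ∨ x.1 = z.1) := by
  have hm : 1 ≤ m.2 := by
    by_contra hcon
    rw [show m.2 = 0 by omega, hB] at lm
    omega
  have key : ∀ {x z : Fin N × ℕ}, SAdj x m → SAdj m z → B x.1 x.2 = 0 → B z.1 z.2 = 0 →
      m.2 = x.2 + 1 → z.2 = m.2 + 1 →
      (contract n B x).2 = (contract n B z).2 ∧ ((contract n B x).2 = 0 ∨ x.1 = z.1) := by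
    intro x z hx hz lx lz e1 e2
    have l2 := hz.leg hm (by omega)
    have lx' : B m.1 x.2 = 0 := by
      by_cases h0 : x.2 = 0
      · rw [h0, hB]
      · rw [← hx.leg (by omega) hm, lx]
    have e : cnt (Kept n (B m.1)) x.2 = cnt (Kept n (B m.1)) z.2 := by
      refine cnt_eq (by omega) fun k k1 k2 hk => ?_
      obtain rfl | rfl : k = m.2 ∨ k = z.2 := by omega
      · exact hk.1 ⟨lm, by rwa [show m.2 - 1 = x.2 by omega], by rwa [← e2, l2]⟩
      · refine hk.2.1 ⟨by omega, by rwa [l2], ?_, ?_⟩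
        · rwa [show z.2 - 1 = m.2 by omega]
        · rwa [show z.2 - 2 = x.2 by omega]
    by_cases h0 : x.2 = 0
    · simp only [contract, ← l2, ← e, h0, cnt, true_and, true_or]
    · have l1 := hx.leg (by omega) hm
      exact ⟨by simp only [contract, ← l2, l1, e], Or.inr (l1.trans l2)⟩
  rcases hx.ht with e1 | e1 <;> rcases hz.ht with e2 | e2
  · exact key hx hz lx lz e1 e2
  · have e : x.2 = z.2 := by omega
    by_cases h0 : x.2 = 0
    · simp only [contract, ← e, h0, cnt, true_and, true_or]
    · have := (hx.leg (by omega) hm).trans (hz.leg hm (by omega))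
      exact ⟨by simp only [contract, this, e], Or.inr this⟩
  · have := (hx.leg (by omega) hm).trans (hz.leg hm (by omega))
    exact ⟨by simp only [contract, this, show x.2 = z.2 by omega], Or.inr this⟩
  · obtain ⟨f1, f2⟩ := key hz.symm hx.symm lz lx (by omega) (by omega)
    exact ⟨f1.symm, f2.imp (fun h => f1 ▸ h) Eq.symm⟩

end contract

section below

variable {V : Type*} {E : V → V → Prop} {n N : ℕ} {B : Fin N → ℕ → ℕ} {A : V → Fin N × ℕ}

lemma Below.congr {A : V → Fin N × ℕ} {x z q : Fin N × ℕ} (h : x.2 = z.2 ∧ (x.2 = 0 ∨ x.1 = z.1))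
    (hb : Below E A z q ∨ Below E A q z) : Below E A x q ∨ Below E A q x := by
  obtain ⟨h1, h2⟩ := h
  by_cases h0 : x.2 = 0
  · rcases hb with hb | hb
    · exact Or.inl ⟨h1 ▸ hb.1, Or.inl h0, h1 ▸ hb.2.2⟩
    · exact absurd hb.1 (by omega)
  · have : x = z := Prod.ext (h2.resolve_left h0) h1
    rwa [this]

lemma below_contract {p q : Fin N × ℕ} (hleg : p.2 = 0 ∨ p.1 = q.1)
    (hk : ∃ k, p.2 < k ∧ k ≤ q.2 ∧ Kept n (B q.1) k)
    (hno : ∀ y, IsEnd E y → (A y).1 = q.1 → p.2 < (A y).2 → (A y).2 < q.2 → False) :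
    Below E (fun y => contract n B (A y)) (contract n B p) (contract n B q) := by
  obtain ⟨k, k1, k2, k3⟩ := hk
  have hp : (contract n B p).2 = cnt (Kept n (B q.1)) p.2 := by
    rcases hleg with h | h
    · simp only [contract, h, cnt]
    · simp only [contract, h]
  refine ⟨?_, ?_, ?_⟩
  · rw [hp]; exact cnt_lt k1 k2 k3
  · rcases hleg with h | h
    · left; rw [hp, h]; rfl
    · exact Or.inr h
  · intro y hy hl h
    simp only [contract] at hl h ⊢
    rw [hl] at h ⊢
    change (contract n B p).2 < _ at h
    rw [hp] at h
    refine cnt_mono _ ?_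
    by_contra hcon
    exact hno y hy hl (lt_of_cnt_lt h) (not_le.1 hcon)

end below

lemma lab_st {n l : ℕ} (hn : 3 ≤ n) (h1 : 1 ≤ l) (h2 : l ≤ n + 2) :
    lab n (stArm n l) (stIdx n l) = if l + 3 ≤ n then n + 2 else if l = n - 2 then n + 1 else
      if l = n - 1 then n else if l = n then n else if l = n + 1 then n + 2 else n + 2 := by
  unfold stArm stIdx
  split_ifs
  all_goals first
    | omega
    | exact lab_n2 hn (Or.inl ⟨by omega, by omega⟩)
    | skip
  · subst l; exact lab_A
  · subst l; exact lab_B3 hn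
  · subst l; exact lab_n hn (Or.inr rfl)
  · subst l; exact lab_B4 hn
  · obtain rfl : l = n + 2 := by omega
    exact lab_n2 hn (Or.inr rfl)

section net

variable {n : ℕ} {V : Type*} {g : V → ℕ} {E : V → V → Prop} {N : ℕ}
    {B : Fin N → ℕ → ℕ} {A : V → Fin N × ℕ} {u v y z : V} {a k₀ k₁ k : ℕ}
    {w : ℕ → Fin N × ℕ}

lemma Rng.src_ne {n a k₀ k₁ : ℕ} (hn : 3 ≤ n) (h : Rng n a k₀ k₁) (h0 : k₀ ≠ 0) :
    1 ≤ srcLab a k₀ ∧ srcLab a k₀ ≤ n + 2 := by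
  rw [srcLab, if_neg h0]
  unfold Rng at h; omega

lemma Rng.tgt_ne {n a k₀ k₁ : ℕ} (hn : 3 ≤ n) (h : Rng n a k₀ k₁) :
    1 ≤ tgtLab a k₀ ∧ tgtLab a k₀ ≤ n + 2 := by
  have e : tgtLab a k₀ = if k₀ = 0 then a else a + 2 := rfl
  generalize tgtLab a k₀ = l at e
  unfold Rng at h
  split_ifs at e <;> omega

lemma Net.isEnd (hn : 3 ≤ n) (H : Net n g E B A) (hy : IsEnd E y) :
    (g y = 0 ∧ B (A y).1 (A y).2 = 0 ∧ ∃ v a k₁ w, IsEdgePath n g E B A y v a 0 k₁ w) ∨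
    ((1 ≤ g y ∧ g y ≤ n + 2) ∧ B (A y).1 (A y).2 = lab n (stArm n (g y)) (stIdx n (g y)) ∧
      ∃ u v k₀ k₁ w, IsEdgePath n g E B A u v (stArm n (g y)) k₀ k₁ w ∧ k₀ ≤ stIdx n (g y) ∧
        stIdx n (g y) ≤ k₁ ∧ w (stIdx n (g y)) = A y) := by
  obtain ⟨u, v, huv, hyuv⟩ := hy
  obtain ⟨a, k₀, k₁, w, P⟩ := H.exists_path huv
  have hlt := P.rng.lt hn
  rcases hyuv with rfl | rfl
  · by_cases h0 : k₀ = 0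
    · subst h0
      left
      refine ⟨by rw [P.src_lab, srcLab, if_pos rfl], ?_, v, a, k₁, w, P⟩
      rw [← P.src, P.lab 0 le_rfl hlt.le, lab_zero]
    · right
      have hr := P.rng.src_ne hn h0
      have hs := P.rng.src hn
      rw [← P.src_lab] at hr hs
      obtain ⟨e1, e2⟩ : stArm n (g y) = a ∧ stIdx n (g y) = k₀ := by
        rcases hs with hs | hs
        · exact absurd hs.1 h0
        · exact hs
      rw [e1, e2]
      refine ⟨hr, by rw [← P.src, P.lab _ le_rfl hlt.le], y, v, k₀, k₁, w, P, le_rfl, hlt.le, P.src⟩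
  · right
    have hr := P.rng.tgt_ne hn
    have hs := P.rng.tgt hn
    rw [← P.tgt_lab] at hr hs
    obtain ⟨e1, e2⟩ := hs
    rw [e1, e2]
    exact ⟨hr, by rw [← P.tgt, P.lab _ hlt.le le_rfl], u, y, k₀, k₁, w, P, hlt.le, le_rfl, P.tgt⟩

lemma Net.isEnd_lab (hn : 3 ≤ n) (H : Net n g E B A) (hy : IsEnd E y) :
    (g y = 0 ∧ B (A y).1 (A y).2 = 0) ∨
    (g y ≠ 0 ∧ n ≤ B (A y).1 (A y).2 ∧ B (A y).1 (A y).2 ≤ n + 2) := by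
  rcases H.isEnd hn hy with h | ⟨h1, h2, -⟩
  · exact Or.inl ⟨h.1, h.2.1⟩
  · rw [lab_st hn h1.1 h1.2] at h2
    right
    split_ifs at h2 <;> omega

/-- Ends of edges at the same position have the same label. -/
lemma Net.lab_eq_of_eq (hn : 3 ≤ n) (hN : N + 1 ≤ n) (H : Net n g E B A) (hy : IsEnd E y)
    (hz : IsEnd E z) (h : A y = A z) : g y = g z := by
  have ly := H.isEnd_lab hn hy
  have lz := H.isEnd_lab hn hz
  rw [← h] at lz
  rcases H.isEnd hn hy with ⟨hy0, -⟩ | ⟨y1, y2, u, v, k₀, k₁, w, P, p1, p2, p3⟩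
  · omega
  rcases H.isEnd hn hz with ⟨hz0, -⟩ | ⟨z1, z2, u', v', k₀', k₁', w', P', p1', p2', p3'⟩
  · omega
  rw [← h] at z2
  have ey := lab_st hn y1.1 y1.2
  have ez := lab_st hn z1.1 z1.2
  rw [← y2] at ey
  rw [← z2] at ez
  by_cases hl : B (A y).1 (A y).2 = n ∨ B (A y).1 (A y).2 = n + 2
  · have harm := H.meet hn hN P P' p1 p2 p1' p2' (by rwa [← y2]) (by rw [p3, p3', h])
    unfold stArm at harm
    split_ifs at ey <;> split_ifs at ez <;> split_ifs at harm <;> omega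
  · split_ifs at ey <;> split_ifs at ez <;> omega

/-- No end of an edge lies on the straight part of a long walk. -/
lemma Net.no_end (hn : 3 ≤ n) (hN : N + 1 ≤ n) (H : Net n g E B A)
    (P : IsEdgePath n g E B A u v a 0 k₁ w) (ha : Long n a) (h2 : 1 ≤ k) (hk : k + 2 < k₁)
    (hy : IsEnd E y) (he : A y = w (k + 2)) (hpos : 1 ≤ (w (k + 2)).2)
    (hst : (w (k + 1)).2 + (w (k + 3)).2 = 2 * (w (k + 2)).2) : False := by
  have hB := H.zero
  have hk₁ := P.rng.le hn
  have c := lab_cases hn ha (k := k + 2) (by omega)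
  have L := P.lab (k + 2) (by omega) (by omega)
  rw [← he] at L
  rcases H.isEnd hn hy with ⟨y0, y1, v', a', k₁', w', P'⟩ |
    ⟨y1, y2, u', v', k₀', k₁', w', P', p1, p2, p3⟩
  · have e1 := P'.rng.lt hn
    have l1 := P'.lab 1 (by omega) (by omega)
    rw [lab_one] at l1
    have hp1 := P'.height_pos hB (k := 1) (by omega) (by omega) (by rw [lab_one]; omega)
    have a1 := P'.adj 0 le_rfl e1
    rw [P'.src, he] at a1
    have g1 := a1.leg hpos hp1
    have t1 := a1.ht
    have b1 := P.adj (k + 1) (by omega) (by omega)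
    have b2 := P.adj (k + 2) (by omega) (by omega)
    have s1 := b1.ht
    simp only [zero_add, show k + 1 + 1 = k + 2 from rfl, show k + 2 + 1 = k + 3 from rfl] at *
    have ne : ∀ j, 2 ≤ j → j ≤ 2 * n → lab n a j ≠ n - 1 := by
      intro j j1 j2 h
      have := lab_cases hn ha j2
      omega
    by_cases h : (w' 1).2 = (w (k + 1)).2
    · have g2 := b1.leg (by omega) hpos
      refine ne (k + 1) (by omega) (by omega) ?_
      rw [← P.lab (k + 1) (by omega) (by omega), ← h, g2, g1, l1]
    · have h' : (w' 1).2 = (w (k + 3)).2 := by omega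
      have g2 := b2.leg hpos (by omega)
      refine ne (k + 3) (by omega) (by omega) ?_
      rw [← P.lab (k + 3) (by omega) (by omega), ← h', ← g2, g1, l1]
  · have e := lab_st hn y1.1 y1.2
    have hk2 : k + 2 = 2 * n - 1 ∧ lab n a (k + 2) = n := by
      rw [← y2] at e
      split_ifs at e <;> omega
    have harm := H.meet hn hN P P' (by omega) (by omega) p1 p2 (Or.inl hk2.2) (by rw [p3, he])
    have hr := P.rng
    unfold Rng at hr
    rw [← y2] at e
    unfold stArm at harm
    split_ifs at e <;> split_ifs at harm <;> omega

end net

section core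

variable {n : ℕ} {V : Type*} {g : V → ℕ} {E : V → V → Prop} {N : ℕ}
    {B : Fin N → ℕ → ℕ} {A : V → Fin N × ℕ} {u v : V} {a k₀ k₁ : ℕ}
    {w : ℕ → Fin N × ℕ}

/-- A step ending outside the labels `< n` stays a step after the contraction. -/
lemma below_step (hn : 3 ≤ n) (hB : ∀ i, B i 0 = 0) {p q : Fin N × ℕ} (h : SAdj p q)
    (hq : n ≤ B q.1 q.2) :
    Below E (fun y => contract n B (A y)) (contract n B p) (contract n B q) ∨
      Below E (fun y => contract n B (A y)) (contract n B q) (contract n B p) := by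
  have hq0 : 1 ≤ q.2 := by
    by_contra hcon
    rw [show q.2 = 0 by omega, hB] at hq
    omega
  rcases h.ht with ht | ht
  · refine Or.inl (below_contract ?_ ⟨q.2, by omega, le_rfl, kept_of_le hn hq⟩
      fun y _ _ h1 h2 => by omega)
    by_cases h0 : p.2 = 0
    · exact Or.inl h0
    · exact Or.inr (h.leg (by omega) hq0)
  · have hl := h.leg (by omega) hq0
    refine Or.inr (below_contract (Or.inr hl.symm) ⟨p.2, by omega, le_rfl, ?_⟩
      fun y _ _ h1 h2 => by omega)
    have e : B p.1 (p.2 - 1) = B q.1 q.2 := by rw [hl, ht]; rfl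
    exact kept_of_above hn (j := p.2 - 1) (by omega) (by omega) (by omega) (by omega)

/-- The main part of a long walk is stretched monotonically by the contraction. -/
lemma Net.below_long (hn : 3 ≤ n) (hN : N + 1 ≤ n) (H : Net n g E B A)
    (P : IsEdgePath n g E B A u v a 0 k₁ w) (ha : Long n a) :
    Below E (fun y => contract n B (A y)) (contract n B (w 2)) (contract n B (w k₁)) ∨
      Below E (fun y => contract n B (A y)) (contract n B (w k₁)) (contract n B (w 2)) := by
  have hB := H.zero
  have hk₁ : k₁ ≤ 2 * n ∧ 2 * n - 1 ≤ k₁ := by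
    have := P.rng; unfold Rng at this; unfold Long at ha; omega
  have htop : n ≤ B (w k₁).1 (w k₁).2 := by
    rw [P.lab k₁ (by omega) le_rfl]
    have := lab_cases hn ha hk₁.1
    omega
  have htop0 : 1 ≤ (w k₁).2 := by
    by_contra hcon
    rw [show (w k₁).2 = 0 by omega, hB] at htop
    omega
  by_cases hz : ∃ i, 2 ≤ i ∧ i ≤ k₁ ∧ (w i).2 = 0
  · left
    classical
    obtain ⟨j, hj2, hjk, hj0, hjm⟩ : ∃ j, 2 ≤ j ∧ j ≤ k₁ ∧ (w j).2 = 0 ∧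
        ∀ i, j < i → i ≤ k₁ → 1 ≤ (w i).2 := by
      obtain ⟨i, i1, i2, i3⟩ := hz
      have hs := Nat.findGreatest_spec (P := fun i => 2 ≤ i ∧ (w i).2 = 0) i2 ⟨i1, i3⟩
      refine ⟨_, hs.1, Nat.findGreatest_le _, hs.2, fun t t1 t2 => ?_⟩
      have := Nat.findGreatest_is_greatest t1 t2
      by_contra hcon
      exact this ⟨hs.1.trans t1.le, by omega⟩
    obtain ⟨j', hj2', hjk', hj0', hjm'⟩ : ∃ j, 2 ≤ j ∧ j ≤ k₁ ∧ (w j).2 = 0 ∧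
        ∀ i, 2 ≤ i → i < j → 1 ≤ (w i).2 := by
      have hs := Nat.find_spec hz
      refine ⟨_, hs.1, hs.2.1, hs.2.2, fun t t1 t2 => ?_⟩
      have := Nat.find_min hz t2
      by_contra hcon
      exact this ⟨t1, by omega, by omega⟩
    have hjlt : j < k₁ := lt_of_le_of_ne hjk fun h => by rw [h] at hj0; omega
    have hjlt' : j' < k₁ := lt_of_le_of_ne hjk' fun h => by rw [h] at hj0'; omega
    have low : (contract n B (w 2)).2 = 0 := by
      rcases hj2'.eq_or_lt with rfl | hlt
      · simp only [contract, hj0', cnt]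
      obtain ⟨i, rfl⟩ : ∃ i, j' = i + 3 := ⟨j' - 3, by omega⟩
      have h1 : (w (i + 2)).2 = 1 := by
        have h1 := (P.adj (i + 2) (by omega) (by omega)).ht
        have := hjm' (i + 2) (by omega) (by omega)
        simp only [show i + 2 + 1 = i + 3 from rfl] at h1
        omega
      have h2 : (w (i + 1)).2 = 2 := by
        have h1' := (P.adj (i + 1) (by omega) (by omega)).ht
        have hp : 1 ≤ (w (i + 1)).2 := by
          rcases Nat.eq_zero_or_pos i with rfl | hi
          · exact P.height_pos hB (by omega) (by omega) (by rw [lab_one]; omega)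
          · exact hjm' (i + 1) (by omega) (by omega)
        simp only [show i + 1 + 1 = i + 2 from rfl] at h1'
        omega
      have D := P.descend hn hB ha (k := i + 1) (by omega) (by rw [h1]) (by
        simp only [show i + 1 + 1 = i + 2 from rfl]; omega)
      simp only [show i + 1 + 1 = i + 2 from rfl, h1] at D
      have lb : ∀ s, s ≤ i + 1 → B (w (i + 2)).1 (1 + s) = lab n a (i + 2 - s) := by
        intro s hs
        rw [← P.lab _ (by omega) (by omega), D s hs]
      have D2 := D i (by omega)
      rw [show i + 2 - i = 2 by omega] at D2
      rw [D2]
      simp only [contract]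
      refine (cnt_eq (h := 0) (by omega) fun k k1 k2 hk => hk.2.2 ⟨1 + i, k2, ?_, ?_⟩).symm
      · rw [show 1 + i + 1 = 1 + (i + 1) by ring, lb _ le_rfl, show i + 2 - (i + 1) = 1 by omega,
          lab_one]
      · intro t ht
        rcases Nat.eq_zero_or_pos t with rfl | ht0
        · rw [hB]; omega
        · obtain ⟨s, rfl⟩ : ∃ s, t = 1 + s := ⟨t - 1, by omega⟩
          rw [lb _ (by omega)]
          have := lab_cases hn ha (k := i + 2 - s) (by omega)
          omega
    have h1 : (w (j + 1)).2 = 1 := by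
      have := (P.adj j (by omega) hjlt).ht
      omega
    have U : ∀ s, j + 1 + s ≤ k₁ → w (j + 1 + s) = ((w (j + 1)).1, 1 + s) := by
      intro s hs
      rcases Nat.eq_zero_or_pos s with rfl | hs0
      · exact Prod.ext rfl h1
      have h2 : (w (j + 1 + 1)).2 = (w (j + 1)).2 + 1 := by
        have := (P.adj (j + 1) (by omega) (by omega)).ht
        have := hjm (j + 1 + 1) (by omega) (by omega)
        omega
      rw [P.ascend hn hB ha (by omega) (by omega) h2 s hs, h1]
    obtain ⟨r, hr⟩ : ∃ r, k₁ = j + 1 + r := ⟨k₁ - (j + 1), by omega⟩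
    have eU : w k₁ = ((w (j + 1)).1, 1 + r) := by rw [hr]; exact U r hr.ge
    have hb := below_contract (E := E) (A := A) (n := n) (B := B) (p := ((w (j + 1)).1, 0))
      (q := w k₁) (Or.inl rfl) ⟨_, htop0, le_rfl, kept_of_le hn htop⟩ (by
        intro y hy hl y1 y2
        simp only [eU] at hl y1 y2
        obtain ⟨s, hs⟩ : ∃ s, (A y).2 = 1 + s := ⟨(A y).2 - 1, by omega⟩
        obtain ⟨i, hi⟩ : ∃ i, j + s = i + 2 := ⟨j + s - 2, by omega⟩
        have es := U s (by omega)
        have es' := U (s + 1) (by omega)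
        rw [show j + 1 + s = i + 1 + 2 by omega] at es
        rw [show j + 1 + (s + 1) = i + 1 + 3 by omega] at es'
        have e0 : (w (i + 1 + 1)).2 = s := by
          rcases Nat.eq_zero_or_pos s with rfl | hs0
          · rw [show i + 1 + 1 = j by omega, hj0]
          · rw [show i + 1 + 1 = j + 1 + (s - 1) by omega, U _ (by omega)]
            simp only; omega
        refine H.no_end hn hN P ha (k := i + 1) (by omega) (by omega) hy ?_ ?_ ?_
        · rw [es]; exact Prod.ext hl hs
        · rw [es]; simp only; omega
        · rw [es, es', e0]; simp only; omega)
    have h0 : (contract n B (((w (j + 1)).1, 0) : Fin N × ℕ)).2 = 0 := rfl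
    exact ⟨by rw [low]; exact h0 ▸ hb.1, Or.inl low, by rw [low]; exact h0 ▸ hb.2.2⟩
  · push Not at hz
    have hpos : ∀ i, 2 ≤ i → i ≤ k₁ → 1 ≤ (w i).2 := fun i i1 i2 =>
      Nat.pos_of_ne_zero (hz i i1 i2)
    rcases (P.adj 2 (by omega) (by omega)).ht with ht | ht
    · left
      have U := P.ascend hn hB ha (k := 2) (by omega) (hpos 2 le_rfl (by omega)) ht
      obtain ⟨r, hr⟩ : ∃ r, k₁ = 2 + r := ⟨k₁ - 2, by omega⟩
      have eU : w k₁ = ((w 2).1, (w 2).2 + r) := by rw [hr]; exact U r hr.ge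
      have e1 := congrArg Prod.fst eU
      have e2 := congrArg Prod.snd eU
      simp only at e1 e2
      refine below_contract (Or.inr e1.symm) ⟨_, by omega, le_rfl, kept_of_le hn htop⟩ ?_
      intro y hy hl y1 y2
      obtain ⟨s, hs⟩ : ∃ s, (A y).2 = (w 2).2 + (s + 1) := ⟨(A y).2 - (w 2).2 - 1, by omega⟩
      have es := U (s + 1) (by omega)
      have es' := U (s + 2) (by omega)
      have e0 := U s (by omega)
      refine H.no_end hn hN P ha (k := s + 1) (by omega) (by omega) hy ?_ ?_ ?_
      · rw [show s + 1 + 2 = 2 + (s + 1) by ring, es]; exact Prod.ext (hl.trans e1) hs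
      · rw [show s + 1 + 2 = 2 + (s + 1) by ring, es]; simp only; omega
      · rw [show s + 1 + 2 = 2 + (s + 1) by ring, es, show s + 1 + 3 = 2 + (s + 2) by ring, es',
          show s + 1 + 1 = 2 + s by ring, e0]
        simp only; omega
    · right
      have down : ∀ i, i + 3 ≤ k₁ → (w (i + 2)).2 = (w (i + 3)).2 + 1 := by
        intro i
        induction i with
        | zero => exact fun _ => ht
        | succ i ih =>
          intro hi
          have h1 := ih (by omega)
          have h2 := P.no_turn hn hB ha (k := i + 2) (by omega) (by omega)
            (hpos _ (by omega) (by omega))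
          have h3 := (P.adj (i + 3) (by omega) (by omega)).ht
          have h4 := hpos (i + 2) (by omega) (by omega)
          simp only [show i + 2 + 2 = i + 3 + 1 from rfl, show i + 1 + 2 = i + 3 from rfl] at *
          omega
      obtain ⟨r, hr⟩ : ∃ r, k₁ = r + 3 := ⟨k₁ - 3, by omega⟩
      have D := P.descend hn hB ha (k := r + 2) (by omega) (hpos _ (by omega) (by omega))
        (down r (by omega))
      simp only [show r + 2 + 1 = r + 3 from rfl] at D
      rw [← hr] at D
      have D2 := D (r + 1) (by omega)
      rw [show k₁ - (r + 1) = 2 by omega] at D2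
      have e1 := congrArg Prod.fst D2
      have e2 := congrArg Prod.snd D2
      simp only at e1 e2
      have D3 := D (k₁ - (2 * n - 3)) (by omega)
      rw [show k₁ - (k₁ - (2 * n - 3)) = 2 * n - 3 by omega] at D3
      have lm := lab_mid hn ha (k := 2 * n - 3) (by omega) (by omega) (by omega)
      rw [← P.lab _ (by omega) (by omega), D3] at lm
      simp only at lm
      refine below_contract (Or.inr e1.symm) ⟨(w k₁).2 + (k₁ - (2 * n - 3)), by omega, by omega,
        kept_of_above hn (j := (w k₁).2) (by omega) ?_ ?_ ?_⟩ ?_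
      · rwa [e1]
      · rw [e1]; omega
      · rw [e1]; omega
      intro y hy hl y1 y2
      obtain ⟨s, hs⟩ : ∃ s, (A y).2 = (w k₁).2 + (s + 1) := ⟨(A y).2 - (w k₁).2 - 1, by omega⟩
      have es := D (s + 1) (by omega)
      have es' := D (s + 2) (by omega)
      have e0 := D s (by omega)
      obtain ⟨i, hi⟩ : ∃ i, k₁ = i + 1 + 3 + s := ⟨r - s - 1, by omega⟩
      rw [show k₁ - (s + 1) = i + 1 + 2 by omega] at es
      rw [show k₁ - (s + 2) = i + 1 + 1 by omega] at es'
      rw [show k₁ - s = i + 1 + 3 by omega] at e0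
      refine H.no_end hn hN P ha (k := i + 1) (by omega) (by omega) hy ?_ ?_ ?_
      · rw [es]; exact Prod.ext (hl.trans e1) hs
      · rw [es]; simp only; omega
      · rw [es, es', e0]; simp only; omega

lemma Net.below_A (hn : 3 ≤ n) (H : Net n g E B A)
    (P : IsEdgePath n g E B A u v (n - 2) 0 2 w) :
    Below E (fun y => contract n B (A y)) (contract n B (w 0)) (contract n B (w 2)) ∨
      Below E (fun y => contract n B (A y)) (contract n B (w 2)) (contract n B (w 0)) := by
  have hB := H.zero
  have l0 := P.lab 0 le_rfl (by omega)
  have l1 := P.lab 1 (by omega) (by omega)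
  have l2 := P.lab 2 (by omega) le_rfl
  rw [lab_zero] at l0
  rw [lab_one] at l1
  rw [lab_A] at l2
  have p1 := P.height_pos hB (k := 1) (by omega) (by omega) (by rw [lab_one]; omega)
  have p2 := P.height_pos hB (k := 2) (by omega) le_rfl (by rw [lab_A]; omega)
  have a0 := P.adj 0 le_rfl (by omega)
  have a1 := P.adj 1 (by omega) (by omega)
  simp only [zero_add, one_add_one_eq_two] at a0 a1
  have g1 := a1.leg p1 p2
  have ne : (w 0).2 ≠ (w 2).2 := by
    intro h
    have g0 := a0.leg (by omega) p1
    rw [g0, g1, h, l2] at l0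
    omega
  have no : ∀ y, IsEnd E y → (A y).1 = (w 1).1 → (A y).2 = (w 1).2 → False := by
    intro y hy y1 y2
    have := H.isEnd_lab hn hy
    rw [y1, y2, l1] at this
    omega
  have t0 := a0.ht
  rcases a1.ht with ht | ht
  · refine Or.inl (below_contract ?_ ⟨(w 2).2, by omega, le_rfl, kept_of_le hn (by omega)⟩
      fun y hy hl h1 h2 => no y hy (hl.trans g1.symm) (by omega))
    by_cases h0 : (w 0).2 = 0
    · exact Or.inl h0
    · exact Or.inr ((a0.leg (by omega) p1).trans g1)
  · have g0 := a0.leg (by omega) p1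
    rw [g1] at l1
    refine Or.inr (below_contract (Or.inr (g0.trans g1).symm) ⟨(w 1).2, by omega, by omega, ?_⟩
      fun y hy hl h1 h2 => no y hy (hl.trans g0) (by omega))
    rw [g0, g1]
    have e : B (w 2).1 ((w 1).2 - 1) = n + 1 := by rw [ht]; exact l2
    exact kept_of_above hn (j := (w 2).2) (by omega) (by omega) (by omega) (by omega)

/-- A net yields a simplicial factorization of the coarse labelled graph. -/
theorem Net.factors (hn : 3 ≤ n) (hN : N + 1 ≤ n) (H : Net n g E B A) : Factors N g E := by
  have hB := H.zero
  refine factors_of_below (fun y => contract n B (A y)) ?_ ?_ ?_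
  · intro y hy h
    rcases H.isEnd_lab hn hy with h1 | ⟨-, h1, -⟩
    · exact h1.1
    · have hp : 0 < (A y).2 := by
        by_contra hcon
        rw [show (A y).2 = 0 by omega, hB] at h1
        omega
      have := cnt_lt hp le_rfl (kept_of_le hn h1)
      simp only [contract] at h
      omega
  · have key : ∀ y z, IsEnd E y → IsEnd E z → (A y).1 = (A z).1 →
        (contract n B (A y)).2 = (contract n B (A z)).2 → (A y).2 < (A z).2 → g y = g z := by
      intro y z hy hz hl h hlt
      simp only [contract, hl] at h
      have hk : ∀ k, (A y).2 < k → k ≤ (A z).2 → ¬ Kept n (B (A z).1) k := fun k k1 k2 k3 => by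
        have := cnt_lt k1 k2 k3
        omega
      rcases H.isEnd_lab hn hz with h1 | ⟨-, h1, -⟩
      · rcases H.isEnd_lab hn hy with h2 | ⟨-, h2, -⟩
        · rw [h1.1, h2.1]
        · rw [hl] at h2
          obtain ⟨k, k1, k2, k3⟩ := exists_kept hn h2 _ hlt h1.2
          exact absurd k3 (hk k k1 k2)
      · exact absurd (kept_of_le hn h1) (hk _ hlt le_rfl)
    intro y z hy hz h
    have e1 := congrArg Prod.fst h
    have e2 := congrArg Prod.snd h
    change (A y).1 = (A z).1 at e1
    rcases lt_trichotomy (A y).2 (A z).2 with h | h | h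
    · exact key y z hy hz e1 e2 h
    · exact H.lab_eq_of_eq hn hN hy hz (Prod.ext e1 h)
    · exact (key z y hz hy e1.symm e2.symm h).symm
  · intro u v huv
    obtain ⟨a, k₀, k₁, w, P⟩ := H.exists_path huv
    have hr := P.rng
    simp only [← P.src, ← P.tgt]
    have fold : k₀ = 0 → 2 ≤ k₁ → lab n a 2 = 0 →
        (contract n B (w 0)).2 = (contract n B (w 2)).2 ∧
          ((contract n B (w 0)).2 = 0 ∨ (contract n B (w 0)).1 = (contract n B (w 2)).1) := by
      rintro rfl h2 hl
      exact contract_fold hn hB (P.adj 0 le_rfl (by omega)) (P.adj 1 (by omega) (by omega))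
        ((P.lab 0 le_rfl (by omega)).trans lab_zero) ((P.lab 1 (by omega) (by omega)).trans lab_one)
        ((P.lab 2 (by omega) h2).trans hl)
    have step : ∀ k, k₀ ≤ k → k < k₁ → n ≤ lab n a (k + 1) →
        Below E (fun y => contract n B (A y)) (contract n B (w k)) (contract n B (w (k + 1))) ∨
        Below E (fun y => contract n B (A y)) (contract n B (w (k + 1))) (contract n B (w k)) := by
      intro k h1 h2 h3
      rw [← P.lab (k + 1) (by omega) h2] at h3
      exact below_step hn hB (P.adj k h1 h2) h3
    by_cases hL : Long n a ∧ k₀ = 0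
    · obtain ⟨ha, rfl⟩ := hL
      have : 2 ≤ k₁ := by unfold Rng at hr; omega
      exact Below.congr (fold rfl this (lab_even hn ha rfl (by omega))) (H.below_long hn hN P ha)
    unfold Long at hL
    unfold Rng at hr
    rcases hr with h | ⟨rfl, rfl, rfl⟩ | ⟨rfl, rfl, rfl⟩ | h | ⟨rfl, rfl, rfl⟩ | ⟨rfl, rfl, rfl⟩
    · omega
    · exact H.below_A hn P
    · exact Below.congr (fold rfl (by omega) (lab_B2 hn)) (step 2 (by omega) (by omega)
        (lab_B3 hn).ge)
    · omega
    · exact step 3 le_rfl (by omega) (by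
        rw [show 3 + 1 = 4 from rfl, lab_B4 hn]; omega)
    · have ha : Long a a := Or.inr rfl
      have := step (2 * a - 1) le_rfl (by omega) (by
        rw [show 2 * a - 1 + 1 = 2 * a by omega, lab_n2 hn ha]; omega)
      rwa [show 2 * a - 1 + 1 = 2 * a by omega] at this

/-- The star of the branch vertex of `X_0` does not map simplicially to a spider with fewer than
`n` legs so that labels are preserved. -/
lemma not_factors_star (hn : 3 ≤ n) (hN : N + 1 ≤ n) (o : V) (x : ℕ → V)
    (hx : ∀ a, 1 ≤ a → a ≤ n → E o (x a) ∧ g (x a) = a) : ¬ Factors N g E := by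
  rintro ⟨B, A, hB, hE⟩
  have lx : ∀ a, 1 ≤ a → a ≤ n → B (A (x a)).1 (A (x a)).2 = a ∧ SAdj (A o) (A (x a)) ∧
      1 ≤ (A (x a)).2 := by
    intro a h1 h2
    obtain ⟨e1, e2⟩ := hx a h1 h2
    obtain ⟨-, e3, e4⟩ := hE _ _ e1
    rw [e2] at e3
    refine ⟨e3, e4, ?_⟩
    by_contra hcon
    rw [show (A (x a)).2 = 0 by omega, hB] at e3
    omega
  have inj : ∀ a b, 1 ≤ a → a ≤ n → 1 ≤ b → b ≤ n → A (x a) = A (x b) → a = b := by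
    intro a b h1 h2 h3 h4 h
    rw [← (lx a h1 h2).1, ← (lx b h3 h4).1, h]
  by_cases h0 : (A o).2 = 0
  · have := Fintype.exists_ne_map_eq_of_card_lt (fun i : Fin n => (A (x (i + 1))).1)
      (by simp; omega)
    obtain ⟨i, j, hij, e⟩ := this
    have hi := lx (i + 1) (by omega) (by omega)
    have hj := lx (j + 1) (by omega) (by omega)
    have ti := hi.2.1.ht
    have tj := hj.2.1.ht
    refine hij (Fin.ext ?_)
    have := inj (i + 1) (j + 1) (by omega) (by omega) (by omega) (by omega)
      (Prod.ext e (by omega))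
    omega
  · have hp : ∀ a, 1 ≤ a → a ≤ n → (A (x a)).1 = (A o).1 ∧
        ((A (x a)).2 = (A o).2 + 1 ∨ (A o).2 = (A (x a)).2 + 1) := fun a h1 h2 =>
      ⟨((lx a h1 h2).2.1.leg (by omega) (lx a h1 h2).2.2).symm, (lx a h1 h2).2.1.ht⟩
    have p1 := hp 1 (by omega) (by omega)
    have p2 := hp 2 (by omega) (by omega)
    have p3 := hp 3 (by omega) (by omega)
    have d12 : (A (x 1)).2 ≠ (A (x 2)).2 := fun h => by
      have := inj 1 2 (by omega) (by omega) (by omega) (by omega)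
        (Prod.ext (p1.1.trans p2.1.symm) h)
      omega
    have d13 : (A (x 1)).2 ≠ (A (x 3)).2 := fun h => by
      have := inj 1 3 (by omega) (by omega) (by omega) (by omega)
        (Prod.ext (p1.1.trans p3.1.symm) h)
      omega
    have d23 : (A (x 2)).2 ≠ (A (x 3)).2 := fun h => by
      have := inj 2 3 (by omega) (by omega) (by omega) (by omega)
        (Prod.ext (p2.1.trans p3.1.symm) h)
      omega
    omega

end core

section reach

variable {V : Type*} {E E' : V → V → Prop} {o u v : V}

/-- The edges of the component of `o`. -/
def Reach (E : V → V → Prop) (o u v : V) : Prop := E u v ∧ Relation.EqvGen E o u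

lemma Reach.eqvGen (h : Relation.EqvGen E u v) (hu : Relation.EqvGen E o u) :
    Relation.EqvGen (Reach E o) u v := by
  induction h with
  | rel x y h => exact .rel _ _ ⟨h, hu⟩
  | refl x => exact .refl _
  | symm x y h ih => exact (ih (hu.trans _ _ _ (h.symm _ _))).symm _ _
  | trans x y z h1 h2 ih1 ih2 => exact (ih1 hu).trans _ _ _ (ih2 (hu.trans _ _ _ h1))

lemma eqvGen_of_chain {p : ℕ → V} {k₀ k₁ : ℕ}
    (h : ∀ k, k₀ ≤ k → k < k₁ → E (p k) (p (k + 1)) ∨ E (p (k + 1)) (p k)) {k : ℕ}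
    (h0 : k₀ ≤ k) (h1 : k ≤ k₁) : Relation.EqvGen E (p k₀) (p k) := by
  induction k, h0 using Nat.le_induction with
  | base => exact .refl _
  | succ j hj ih =>
    refine (ih (by omega)).trans _ _ _ ?_
    rcases h j hj (by omega) with h | h
    · exact .rel _ _ h
    · exact .symm _ _ (.rel _ _ h)

/-- If every edge of `E` is subdivided in `E'` as an edge of `X_0` is subdivided in `X_1`, then a
factorization of `E'` through a spider with fewer than `n` legs induces one of `E`. -/
theorem Factors.descend {n N : ℕ} {g : V → ℕ} (hn : 3 ≤ n) (hN : N + 1 ≤ n) (F : V → V)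
    (ho : F o = o)
    (hE : ∀ u v, E u v → ∃ a k₀ k₁, ∃ p : ℕ → V, Rng n a k₀ k₁ ∧ g u = srcLab a k₀ ∧
      g v = tgtLab a k₀ ∧ p k₀ = F u ∧ p k₁ = F v ∧
      (∀ k, k₀ ≤ k → k < k₁ → E' (p k) (p (k + 1)) ∨ E' (p (k + 1)) (p k)) ∧
      ∀ k, k₀ ≤ k → k ≤ k₁ → g (p k) = lab n a k)
    (h : Factors N g (Reach E' o)) : Factors N g (Reach E o) := by
  obtain ⟨B, A, hB, hA⟩ := h
  have lift : ∀ {x y}, Relation.EqvGen E x y → Relation.EqvGen E' (F x) (F y) := by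
    intro x y h
    induction h with
    | rel x y h =>
      obtain ⟨a, k₀, k₁, p, hr, -, -, h0, h1, hc, -⟩ := hE x y h
      rw [← h0, ← h1]
      exact eqvGen_of_chain hc (hr.lt hn).le le_rfl
    | refl x => exact .refl _
    | symm x y _ ih => exact .symm _ _ ih
    | trans x y z _ _ ih1 ih2 => exact .trans _ _ _ ih1 ih2
  have H : Net n g (Reach E o) B (A ∘ F) := by
    refine ⟨hB, ?_, ?_⟩
    · rintro u v ⟨huv, hu⟩
      obtain ⟨a, k₀, k₁, p, hr, hs, ht, h0, h1, hc, hl⟩ := hE u v huv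
      have hu' := lift hu
      rw [ho, ← h0] at hu'
      have hp : ∀ k, k₀ ≤ k → k < k₁ → (B (A (p k)).1 (A (p k)).2 = g (p k) ∧
          B (A (p (k + 1))).1 (A (p (k + 1))).2 = g (p (k + 1)) ∧
          SAdj (A (p k)) (A (p (k + 1)))) := by
        intro k k1 k2
        rcases hc k k1 k2 with h | h
        · exact hA _ _ ⟨h, hu'.trans _ _ _ (eqvGen_of_chain hc k1 k2.le)⟩
        · obtain ⟨e1, e2, e3⟩ := hA _ _
            ⟨h, hu'.trans _ _ _ (eqvGen_of_chain hc (k := k + 1) (by omega) k2)⟩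
          exact ⟨e2, e1, e3.symm⟩
      refine ⟨a, k₀, k₁, fun k => A (p k), ⟨hr, fun k k1 k2 => (hp k k1 k2).2.2, ?_⟩,
        congrArg A h0, congrArg A h1, hs, ht⟩
      intro k k1 k2
      rw [← hl k k1 k2]
      rcases k2.lt_or_eq with k2 | rfl
      · exact (hp k k1 k2).1
      · have := hr.lt hn
        obtain ⟨j, rfl⟩ : ∃ j, k = j + 1 := ⟨k - 1, by omega⟩
        exact (hp j (by omega) (by omega)).2.1
    · rintro u v u' v' ⟨-, hu⟩ ⟨-, hu'⟩
      exact Reach.eqvGen ((hu.symm _ _).trans _ _ _ hu') hu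
  exact H.factors hn hN

end reach

section coordinates

variable {n a k k₀ k₁ j l l' : ℕ} {s t : ℝ}

lemma embC_zero (n i : ℕ) : embC n (i, 0) = 0 := by simp [embC]

lemma norm_embC (n : ℕ) (p : ℕ × ℝ) : ‖embC n p‖ = min 1 (max 0 p.2) := by
  have h : (2 * Real.pi * Complex.I * (p.1 : ℂ) / (n : ℂ)) =
      ((2 * Real.pi * p.1 / n : ℝ) : ℂ) * Complex.I := by push_cast; ring
  have h0 : 0 ≤ min 1 (max 0 p.2) := le_min zero_le_one (le_max_left _ _)
  rw [embC, h, norm_mul, Complex.norm_exp_ofReal_mul_I, mul_one, Complex.norm_real,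
    Real.norm_eq_abs, abs_of_nonneg h0]

lemma embC_inj (hn : n ≠ 0) {p q : ℕ × ℝ} (h : embC n p = embC n q) :
    min 1 (max 0 p.2) = min 1 (max 0 q.2) ∧ (min 1 (max 0 p.2) = 0 ∨ p.1 % n = q.1 % n) := by
  have h1 : min 1 (max 0 p.2) = min 1 (max 0 q.2) := by rw [← norm_embC n p, h, norm_embC]
  refine ⟨h1, or_iff_not_imp_left.2 fun h0 => ?_⟩
  rw [embC, embC, ← h1] at h
  have h2 := mul_left_cancel₀ (Complex.ofReal_ne_zero.2 h0) h
  obtain ⟨k, hk⟩ := Complex.exp_eq_exp_iff_exists_int.1 h2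
  have hn' : (n : ℂ) ≠ 0 := Nat.cast_ne_zero.2 hn
  have hpi : (2 * Real.pi * Complex.I : ℂ) ≠ 0 := Complex.two_pi_I_ne_zero
  have h3 : (p.1 : ℂ) = q.1 + k * n := by
    field_simp at hk
    have := mul_left_cancel₀ hpi (a := (2 * Real.pi * Complex.I : ℂ)) (b := (p.1 : ℂ))
      (c := q.1 + k * n) (by linear_combination (2 * Real.pi * Complex.I : ℂ) * hk)
    exact this
  have h4 : (p.1 : ℤ) = q.1 + k * n := by exact_mod_cast h3
  have h5 : ((p.1 : ℤ) % n) = (q.1 : ℤ) % n := by rw [h4, Int.add_mul_emod_self_right]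
  exact_mod_cast h5

lemma segOf_zero (n a : ℕ) : segOf n a 0 = (0, 0) := by
  simp [segOf]

lemma imgCoord_zero (n a : ℕ) : imgCoord n a 0 = (0, 0) := by
  simp [imgCoord, vcoord]

lemma embC_interpC_zero (w w' : ℕ × ℝ) : embC n (interpC w w' 0) = embC n w := by
  simp only [interpC, sub_zero, one_mul, zero_mul, add_zero]
  split_ifs with h
  · rw [h, embC_zero, ← embC_zero n w.1, ← h]
  · rfl

lemma embC_interpC_one {w w' : ℕ × ℝ} (h : w.2 = 0 ∨ w'.2 = 0 ∨ w.1 = w'.1) :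
    embC n (interpC w w' 1) = embC n w' := by
  simp only [interpC, sub_self, one_mul, zero_mul, zero_add]
  split_ifs with h0
  · rfl
  · rcases h with h | h | h
    · exact absurd h h0
    · rw [h, embC_zero, ← embC_zero n w'.1, ← h]
    · rw [h]

lemma fS_embC (hn : n ≠ 0) (p : ℕ × ℝ) (hp : embC n p ∈ Sset n) :
    (fS n ⟨embC n p, hp⟩ : ℂ) = embC n (Gmap n p) := by
  have h : embC n (Function.invFun (embC n) (embC n p)) = embC n p :=
    Function.invFun_eq ⟨p, rfl⟩
  obtain ⟨h1, h2⟩ := embC_inj hn h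
  simp only [fS]
  generalize Function.invFun (embC n) (embC n p) = q at h1 h2
  have hz : ∀ q : ℕ × ℝ, min 1 (max 0 q.2) = 0 → embC n (Gmap n q) = 0 := by
    intro q hq
    rw [Gmap, hq, segOf_zero, embC_interpC_zero, imgCoord_zero, embC_zero]
  rcases h2 with h2 | h2
  · rw [hz q h2, hz p (h1 ▸ h2)]
  · rw [Gmap, Gmap, h1, h2]

lemma imgCoord_eq (hn : 3 ≤ n) (h : Rng n a k₀ k₁) (hk : k ≤ k₁) :
    imgCoord n a k = vcoord n (lab n a k) := by
  have hle := h.le hn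
  have hc := h.cases hn
  by_cases h0 : k = 0
  · subst h0; simp [imgCoord_zero, lab_zero, vcoord]
  by_cases h1 : k = 1
  · subst h1
    rw [lab_one, imgCoord]
    have : 1 ≤ 2 * n - 2 := by omega
    have : 1 ≤ 2 * n - 1 := by omega
    simp [*]
  rcases hc with ⟨ha, -⟩ | ⟨rfl, hk'⟩ | ⟨rfl, hk'⟩
  · rw [lab_long hn ha h0 h1]
    rcases ha with ⟨ha1, ha2⟩ | rfl
    · rw [imgCoord, if_neg (by omega), if_neg (by omega), if_neg (by omega), if_neg h0]
      by_cases h2 : k = 2 * n - 1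
      · rw [if_pos (by omega), if_neg h1, if_pos h2, if_pos h2]
      simp only [if_neg h2]
      by_cases h3 : 2 * n ≤ k
      · rw [if_neg (by omega), if_pos h3]
      rw [if_pos (by omega), if_neg h1, if_neg h3]
      by_cases h4 : k % 2 = 0
      · rw [if_pos (by omega), if_pos h4]
      rw [if_neg (by omega), if_neg h4, slot, if_neg (by omega), sig]
      congr 1
      split_ifs with h5
      · rw [Nat.mod_eq_of_lt (by omega)]; omega
      · rw [Nat.mod_eq_sub_mod (by omega), Nat.mod_eq_of_lt (by omega)]; omega
    · rw [imgCoord, if_pos rfl, if_neg h0]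
      by_cases h2 : k = 2 * a - 1
      · rw [if_neg (by omega), if_pos h2, if_pos h2]
      simp only [if_neg h2]
      by_cases h3 : 2 * a ≤ k
      · rw [if_neg (by omega), if_pos h3]
      rw [if_pos (by omega), if_neg h1, if_neg h3]
      by_cases h4 : k % 2 = 0
      · rw [if_pos h4, if_pos h4]
      rw [if_neg h4, if_neg h4, slot, if_pos rfl, sig]
      by_cases h5 : k = 3
      · rw [if_pos h5, if_pos (by omega)]
        congr 1; omega
      · rw [if_neg h5, if_neg (by omega)]
        congr 1; omega
  · obtain rfl : k = 2 := by omega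
    rw [lab_A, imgCoord, if_neg (by omega), if_neg (by omega), if_pos rfl]
    simp
  · rw [imgCoord, if_neg (by omega), if_pos rfl]
    obtain rfl | rfl | rfl : k = 2 ∨ k = 3 ∨ k = 4 := by omega
    · simp [lab_B2 hn]
    · simp [lab_B3 hn]
    · simp [lab_B4 hn]

/-- The oriented edges of `X_0`. -/
def XEdge (n l l' : ℕ) : Prop := ∃ a k₀ k₁, Rng n a k₀ k₁ ∧ l = srcLab a k₀ ∧ l' = tgtLab a k₀

lemma xEdge_iff (hn : 3 ≤ n) : XEdge n l l' ↔
    (l = 0 ∧ 1 ≤ l' ∧ l' ≤ n) ∨ (l = n - 1 ∧ l' = n + 1) ∨ (l = n ∧ l' = n + 2) := by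
  constructor
  · rintro ⟨a, k₀, k₁, h, e1, e2⟩
    unfold srcLab at e1
    unfold tgtLab at e2
    unfold Rng at h
    split_ifs at e1 <;> split_ifs at e2 <;> omega
  · rintro (⟨rfl, h1, h2⟩ | ⟨rfl, rfl⟩ | ⟨rfl, rfl⟩)
    · refine ⟨l', 0, if l' + 3 ≤ n then 2 * n else if l' = n - 2 then 2 else
        if l' = n - 1 then 3 else 2 * n - 1, ?_, rfl, rfl⟩
      unfold Rng
      split_ifs <;> omega
    · refine ⟨n - 1, 3, 4, ?_, rfl, ?_⟩
      · unfold Rng; omega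
      · rw [tgtLab, if_neg (by omega)]; omega
    · refine ⟨l, 2 * l - 1, 2 * l, ?_, ?_, ?_⟩
      · unfold Rng; omega
      · rw [srcLab, if_neg (by omega)]
      · rw [tgtLab, if_neg (by omega)]

/-- Consecutive labels on an arm span an edge of `X_0`. -/
lemma xEdge_lab (hn : 3 ≤ n) (h : Rng n a k₀ k₁) (hk : k < k₁) :
    XEdge n (lab n a k) (lab n a (k + 1)) ∨ XEdge n (lab n a (k + 1)) (lab n a k) := by
  rw [xEdge_iff hn, xEdge_iff hn]
  have h1 := h.lab_cases hn hk.le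
  have h2 := h.lab_cases hn (k := k + 1) hk
  have := not_long_A hn
  have := not_long_B hn
  rcases h1 with ⟨hL, h1⟩ | ⟨rfl, h1⟩ | ⟨rfl, h1⟩
  · rcases h2 with ⟨-, h2⟩ | ⟨rfl, h2⟩ | ⟨rfl, h2⟩
    · omega
    · contradiction
    · contradiction
  · rcases h2 with ⟨hL, -⟩ | ⟨-, h2⟩ | ⟨h3, -⟩
    · contradiction
    · omega
    · omega
  · rcases h2 with ⟨hL, -⟩ | ⟨h3, -⟩ | ⟨-, h2⟩
    · contradiction
    · omega
    · omega

lemma vcoord_zero (n : ℕ) : vcoord n 0 = (0, 0) := by simp [vcoord]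

lemma vcoord_pos (hl : l ≠ 0) : (vcoord n l).2 ≠ 0 := by
  unfold vcoord; split_ifs <;> simp_all

/-- The ray of a vertex of `X_0`. -/
lemma vcoord_ray (hn : 3 ≤ n) : (vcoord n (n - 1)).1 = (vcoord n (n + 1)).1 ∧
    (vcoord n n).1 = (vcoord n (n + 2)).1 := by
  constructor
  · rw [vcoord, vcoord, if_neg (by omega), if_neg (by omega), if_pos rfl, if_neg (by omega),
      if_neg (by omega), if_neg (by omega), if_neg (by omega), if_pos rfl]
  · rw [vcoord, vcoord, if_neg (by omega), if_neg (by omega), if_neg (by omega), if_pos rfl,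
      if_neg (by omega), if_neg (by omega), if_neg (by omega), if_neg (by omega),
      if_neg (by omega)]

lemma XEdge.coord (hn : 3 ≤ n) (h : XEdge n l l') :
    (vcoord n l').2 ≠ 0 ∧ ((vcoord n l).2 = 0 ∨
      (vcoord n l).2 ≠ 0 ∧ (vcoord n l).1 = (vcoord n l').1) := by
  rw [xEdge_iff hn] at h
  refine ⟨vcoord_pos (by omega), ?_⟩
  rcases h with ⟨rfl, -⟩ | ⟨rfl, rfl⟩ | ⟨rfl, rfl⟩
  · left; rw [vcoord_zero]
  · exact Or.inr ⟨vcoord_pos (by omega), (vcoord_ray hn).1⟩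
  · exact Or.inr ⟨vcoord_pos (by omega), (vcoord_ray hn).2⟩

/-- The affine parametrization of an edge of `X_0`. -/
noncomputable def seg (n l l' : ℕ) (t : ℝ) : Sspace n :=
  ⟨embC n (interpC (vcoord n l) (vcoord n l') t), Set.mem_range_self _⟩

lemma seg_zero : seg n l l' 0 = vpt n l := Subtype.ext (embC_interpC_zero _ _)

lemma XEdge.seg_one (hn : 3 ≤ n) (h : XEdge n l l') : seg n l l' 1 = vpt n l' :=
  Subtype.ext (embC_interpC_one (by have := h.coord hn; tauto))

lemma XEdge.seg_symm (hn : 3 ≤ n) (h : XEdge n l l') (t : ℝ) :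
    seg n l' l t = seg n l l' (1 - t) := by
  obtain ⟨h1, h2⟩ := h.coord hn
  refine Subtype.ext (congrArg (embC n) ?_)
  unfold interpC
  refine Prod.ext ?_ (by simp only; ring)
  simp only [if_neg h1]
  rcases h2 with h2 | ⟨h2, h3⟩
  · rw [if_pos h2]
  · rw [if_neg h2, h3]

lemma floor_spec {M j : ℕ} {s x : ℝ} (hj : j < M) (h0 : 0 ≤ s) (h1 : s ≤ 1) (hx : x = j + s) :
    ((min (M - 1) ⌊x⌋₊, x - (min (M - 1) ⌊x⌋₊ : ℕ)) : ℕ × ℝ) = (j, s) ∨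
      s = 1 ∧ ((min (M - 1) ⌊x⌋₊, x - (min (M - 1) ⌊x⌋₊ : ℕ)) : ℕ × ℝ) = (j + 1, 0) := by
  subst hx
  rcases h1.lt_or_eq with h1 | rfl
  · have : ⌊(j : ℝ) + s⌋₊ = j := by
      rw [Nat.floor_eq_iff (by positivity)]
      constructor <;> linarith
    rw [this, min_eq_right (by omega)]
    left; simp
  · have : ⌊(j : ℝ) + 1⌋₊ = j + 1 := by
      rw [Nat.floor_eq_iff (by positivity)]
      push_cast
      constructor <;> linarith
    rw [this]
    by_cases h : j + 1 < M
    · right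
      rw [min_eq_right (by omega)]
      refine ⟨rfl, ?_⟩
      push_cast; simp
    · left
      rw [min_eq_left (by omega), show M - 1 = j by omega]
      simp

/-- The parameter on the `a`-th ray of the point at parameter `t` on an edge of `X_0`. -/
lemma interp_coord (hn : 3 ≤ n) (h : Rng n a k₀ k₁) (t : ℝ) :
    interpC (vcoord n (srcLab a k₀)) (vcoord n (tgtLab a k₀)) t =
      (a - 1, if a + 2 ≤ n then t else if k₀ = 0 then t / 2 else (1 + t) / 2) := by
  unfold srcLab tgtLab
  by_cases h0 : k₀ = 0
  · rw [if_pos h0, if_pos h0, if_pos h0, vcoord_zero, interpC, if_pos rfl, vcoord]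
    have ha : 1 ≤ a ∧ a ≤ n := by unfold Rng at h; omega
    rw [if_neg (by omega)]
    by_cases h1 : a + 2 ≤ n
    · rw [if_pos (by omega), if_pos h1]; simp
    rw [if_neg (by omega), if_neg h1]
    by_cases h2 : a = n - 1
    · rw [if_pos h2]
      refine Prod.ext (by simp only; omega) (by simp only; ring)
    · rw [if_neg h2, if_pos (by omega)]
      refine Prod.ext (by simp only; omega) (by simp only; ring)
  · rw [if_neg h0, if_neg h0, if_neg h0, interpC, if_neg (vcoord_pos (by unfold Rng at h; omega)),
      vcoord, vcoord]
    have ha : a = n - 1 ∨ a = n := by unfold Rng at h; omega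
    rcases ha with rfl | rfl
    · rw [if_neg (by omega), if_neg (by omega), if_pos rfl, if_neg (by omega), if_neg (by omega),
        if_neg (by omega), if_neg (by omega), if_pos (by omega), if_neg (by omega)]
      refine Prod.ext (by simp only; omega) (by simp only; ring)
    · rw [if_neg (by omega), if_neg (by omega), if_neg (by omega), if_pos rfl, if_neg (by omega),
        if_neg (by omega), if_neg (by omega), if_neg (by omega), if_neg (by omega),
        if_neg (by omega)]
      refine Prod.ext (by simp only) (by simp only; ring)

lemma segOf_spec (hn : 3 ≤ n) (h : Rng n a k₀ k₁) (hj : k₀ + j < k₁) (h0 : 0 ≤ s) (h1 : s ≤ 1)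
    (ht : t = (j + s) / ((k₁ - k₀ : ℕ) : ℝ)) :
    let p := segOf n a (if a + 2 ≤ n then t else if k₀ = 0 then t / 2 else (1 + t) / 2)
    p = (k₀ + j, s) ∨ (s = 1 ∧ p = (k₀ + j + 1, 0)) ∨
      (s = 0 ∧ p = (k₀ + j - 1, 1) ∧ lab n a (k₀ + j - 1) = 0 ∧ 1 ≤ k₀ + j) := by
  intro p
  have hn' : (3 : ℝ) ≤ n := by exact_mod_cast hn
  have red : ∀ {P Q R : Prop}, P ∨ Q → P ∨ Q ∨ R := by tauto
  rcases h with ⟨ha, ha', rfl, rfl⟩ | ⟨rfl, rfl, rfl⟩ | ⟨rfl, rfl, rfl⟩ | ⟨rfl, rfl, rfl⟩ |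
    ⟨rfl, rfl, rfl⟩ | ⟨rfl, rfl, rfl⟩
  · refine red ?_
    simp only [p]
    rw [if_pos (by omega), segOf, if_neg (by omega), if_neg (by omega), if_neg (by omega)]
    simp only [zero_add] at hj ⊢
    refine floor_spec hj h0 h1 ?_
    rw [ht, Nat.sub_zero]; push_cast; field_simp
  · refine red ?_
    simp only [p]
    rw [if_pos (by omega), segOf, if_neg (by omega), if_neg (by omega), if_pos rfl]
    simp only [zero_add] at hj ⊢
    refine floor_spec (M := 2) hj h0 h1 ?_
    rw [ht]; push_cast; field_simp
  · refine red ?_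
    simp only [p]
    have hj' : (j : ℝ) + 1 ≤ 3 := by exact_mod_cast (by omega : j + 1 ≤ 3)
    have : t / 2 ≤ 1 / 2 := by rw [ht]; push_cast; linarith
    rw [if_neg (by omega), if_pos trivial, segOf, if_neg (by omega), if_pos rfl, if_pos this]
    simp only [zero_add] at hj ⊢
    refine floor_spec (M := 3) hj h0 h1 ?_
    rw [ht]; push_cast; field_simp; ring
  · refine red ?_
    simp only [p]
    have hc : ((2 * a - 1 - 0 : ℕ) : ℝ) = 2 * a - 1 := by
      rw [Nat.sub_zero, Nat.cast_sub (by omega)]; push_cast; ring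
    rw [hc] at ht
    have hj' : (j : ℝ) + 1 ≤ 2 * a - 1 := by
      rw [← hc]; exact_mod_cast (by omega : j + 1 ≤ 2 * a - 1 - 0)
    have hpos : (0 : ℝ) < 2 * a - 1 := by linarith
    have : t / 2 ≤ 1 / 2 := by
      have : t ≤ 1 := by rw [ht, div_le_one hpos]; linarith
      linarith
    rw [if_neg (by omega), if_pos trivial, segOf, if_pos rfl, if_pos this]
    simp only [zero_add] at hj ⊢
    refine floor_spec (M := 2 * a - 1) hj h0 h1 ?_
    linarith [(eq_div_iff hpos.ne').1 ht]
  · obtain rfl : j = 0 := by omega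
    simp only [p]
    rw [if_neg (by omega), if_neg (by omega), segOf, if_neg (by omega), if_pos rfl]
    have ht' : t = s := by rw [ht]; norm_num
    subst ht'
    rcases h0.eq_or_lt with rfl | h0
    · right; right
      norm_num
      have : ⌊(3 : ℝ)⌋₊ = 3 := by norm_num
      norm_num [lab_B2 hn]
    · left
      rw [if_neg (by linarith)]
      refine Prod.ext rfl (by simp only; ring)
  · obtain rfl : j = 0 := by omega
    simp only [p]
    rw [if_neg (by omega), if_neg (by omega), segOf, if_pos rfl]
    have ht' : t = s := by
      rw [ht, show 2 * a - (2 * a - 1) = 1 by omega]; norm_num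
    subst ht'
    rcases h0.eq_or_lt with rfl | h0
    · right; right
      rw [if_pos (by norm_num)]
      have e : (4 * (a : ℝ) - 2) * ((1 + 0) / 2) = ((2 * a - 1 : ℕ) : ℝ) := by
        rw [Nat.cast_sub (by omega)]; push_cast; ring
      rw [e, Nat.floor_natCast, min_eq_left (by omega)]
      refine ⟨rfl, Prod.ext rfl ?_, lab_even hn (Or.inr rfl) (by omega) (by omega), by omega⟩
      simp only
      rw [show 2 * a - 1 = 2 * a - 2 + 1 by omega]
      push_cast; ring
    · left
      rw [if_neg (by linarith)]
      refine Prod.ext rfl (by simp only; ring)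

/-- The bonding map subdivides the edges of `X_0` along the arms of `X_1`. -/
lemma fS_seg (hn : 3 ≤ n) (h : Rng n a k₀ k₁) (hj : k₀ + j < k₁) (h0 : 0 ≤ s) (h1 : s ≤ 1) :
    fS n (seg n (srcLab a k₀) (tgtLab a k₀) ((j + s) / ((k₁ - k₀ : ℕ) : ℝ))) =
      seg n (lab n a (k₀ + j)) (lab n a (k₀ + j + 1)) s := by
  obtain ⟨t, ht⟩ : ∃ t : ℝ, t = (j + s) / ((k₁ - k₀ : ℕ) : ℝ) := ⟨_, rfl⟩
  rw [← ht]
  have hM : (0 : ℝ) < ((k₁ - k₀ : ℕ) : ℝ) := by exact_mod_cast (by omega : 0 < k₁ - k₀)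
  have hj' : (j : ℝ) + 1 ≤ ((k₁ - k₀ : ℕ) : ℝ) := by exact_mod_cast (by omega : j + 1 ≤ k₁ - k₀)
  have t0 : 0 ≤ t := by rw [ht]; positivity
  have t1 : t ≤ 1 := by rw [ht, div_le_one hM]; linarith
  refine Subtype.ext ?_
  refine (fS_embC (by omega) _ _).trans ?_
  rw [interp_coord hn h]
  have ha : (a - 1) % n + 1 = a := by
    rw [Nat.mod_eq_of_lt (by unfold Rng at h; omega)]
    unfold Rng at h; omega
  have hs := segOf_spec hn h hj h0 h1 ht
  set x : ℝ := if a + 2 ≤ n then t else if k₀ = 0 then t / 2 else (1 + t) / 2 with hx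
  have x0 : 0 ≤ x := by rw [hx]; split_ifs <;> linarith
  have x1 : x ≤ 1 := by rw [hx]; split_ifs <;> linarith
  simp only [Gmap, ha]
  rw [max_eq_right x0, min_eq_right x1]
  have i1 := imgCoord_eq hn h (k := k₀ + j) hj.le
  have i2 := imgCoord_eq hn h (k := k₀ + j + 1) hj
  simp only [seg, ← i1, ← i2]
  rcases hs with hs | ⟨rfl, hs⟩ | ⟨rfl, hs, hl, hp⟩
  · rw [hs]
  · rw [hs, embC_interpC_zero, embC_interpC_one]
    rw [i1, i2]
    rcases xEdge_lab hn h (k := k₀ + j) hj with he | he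
    · have := he.coord hn; tauto
    · have := he.coord hn
      rcases this with ⟨c1, c2 | ⟨c2, c3⟩⟩
      · exact Or.inr (Or.inl c2)
      · exact Or.inr (Or.inr c3.symm)
  · rw [hs, embC_interpC_zero, show k₀ + j - 1 + 1 = k₀ + j by omega, embC_interpC_one]
    left
    rw [imgCoord_eq hn h (k := k₀ + j - 1) (by omega), hl, vcoord_zero]

end coordinates

open Set

section pieces

variable {n N m : ℕ}

/-- Adjacency between the (labelled) vertices of `X_m`: an oriented edge is an arc that `f^m` maps
affinely onto an edge of `X_0`. -/
def ArcAdj (n m : ℕ) (u v : Sspace n × ℕ) : Prop :=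
  XEdge n u.2 v.2 ∧ ∃ c : ℝ → Sspace n, ContinuousOn c (Icc 0 1) ∧ c 0 = u.1 ∧ c 1 = v.1 ∧
    ∀ t ∈ Icc (0 : ℝ) 1, (fS n)^[m] (c t) = seg n u.2 v.2 t

/-- Reading the label of a vertex of `X_m` after one more application of `f`. -/
def relabel (n : ℕ) (u : Sspace n × ℕ) : Sspace n × ℕ :=
  (u.1, lab n (stArm n u.2) (stIdx n u.2))

lemma arcAdj_of_path {c : ℝ → Sspace n} {l l' : ℕ} (hn : 3 ≤ n) (hc : ContinuousOn c (Icc 0 1))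
    (hx : XEdge n l l' ∨ XEdge n l' l)
    (h : ∀ t ∈ Icc (0 : ℝ) 1, (fS n)^[m] (c t) = seg n l l' t) :
    ArcAdj n m (c 0, l) (c 1, l') ∨ ArcAdj n m (c 1, l') (c 0, l) := by
  rcases hx with hx | hx
  · exact Or.inl ⟨hx, c, hc, rfl, rfl, h⟩
  · refine Or.inr ⟨hx, fun t => c (1 - t), hc.comp (by fun_prop) ?_, by simp, by simp, ?_⟩
    · intro t ht; exact ⟨by linarith [ht.2], by linarith [ht.1]⟩
    · intro t ht
      rw [h _ ⟨by linarith [ht.2], by linarith [ht.1]⟩, hx.seg_symm hn]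
      simp

/-- Every edge of `X_m` is subdivided in `X_(m+1)` as an edge of `X_0` is in `X_1`. -/
lemma ArcAdj.subdivide (hn : 3 ≤ n) {u v : Sspace n × ℕ} (h : ArcAdj n m u v) :
    ∃ a k₀ k₁, ∃ p : ℕ → Sspace n × ℕ, Rng n a k₀ k₁ ∧ u.2 = srcLab a k₀ ∧ v.2 = tgtLab a k₀ ∧
      p k₀ = relabel n u ∧ p k₁ = relabel n v ∧
      (∀ k, k₀ ≤ k → k < k₁ →
        ArcAdj n (m + 1) (p k) (p (k + 1)) ∨ ArcAdj n (m + 1) (p (k + 1)) (p k)) ∧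
      ∀ k, k₀ ≤ k → k ≤ k₁ → (p k).2 = lab n a k := by
  obtain ⟨⟨a, k₀, k₁, hr, hs, ht⟩, c, hc, c0, c1, hf⟩ := h
  have hlt := hr.lt hn
  have hM : (0 : ℝ) < ((k₁ - k₀ : ℕ) : ℝ) := by exact_mod_cast (by omega : 0 < k₁ - k₀)
  refine ⟨a, k₀, k₁, fun k => (c (((k - k₀ : ℕ) : ℝ) / ((k₁ - k₀ : ℕ) : ℝ)), lab n a k), hr, hs,
    ht, ?_, ?_, ?_, fun _ _ _ => rfl⟩
  · refine Prod.ext (by simp [relabel, c0]) ?_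
    simp only [relabel, hs]
    rcases hr.src hn with ⟨h1, h2⟩ | ⟨h1, h2⟩
    · rw [h2, h1, lab_zero, lab_zero]
    · rw [h1, h2]
  · refine Prod.ext (by simp [relabel, c1, hM.ne']) ?_
    simp only [relabel, ht]
    rw [(hr.tgt hn).1, (hr.tgt hn).2]
  · intro k h0 h1
    obtain ⟨j, rfl⟩ := Nat.exists_eq_add_of_le h0
    have hj : (j : ℝ) + 1 ≤ ((k₁ - k₀ : ℕ) : ℝ) := by
      exact_mod_cast (by omega : j + 1 ≤ k₁ - k₀)
    have hmaps : MapsTo (fun t : ℝ => (j + t) / ((k₁ - k₀ : ℕ) : ℝ)) (Icc 0 1) (Icc 0 1) := by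
      intro t ht
      refine ⟨div_nonneg (by linarith [ht.1, (Nat.cast_nonneg j : (0 : ℝ) ≤ j)]) hM.le, ?_⟩
      rw [div_le_one hM]
      linarith [ht.2]
    have := arcAdj_of_path (m := m + 1) hn
      (c := fun t => c ((j + t) / ((k₁ - k₀ : ℕ) : ℝ)))
      (hc.comp (by fun_prop) hmaps) (xEdge_lab hn hr h1) (by
        intro t htt
        rw [Function.iterate_succ_apply', hf _ (hmaps htt), hs, ht, fS_seg hn hr h1 htt.1 htt.2])
    simp only [add_zero] at this
    beta_reduce
    rw [show k₀ + j + 1 - k₀ = j + 1 by omega, show k₀ + j - k₀ = j by omega]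
    push_cast
    exact this

/-- The branch point of `X_m`. -/
noncomputable def center (n : ℕ) : Sspace n × ℕ := (vpt n 0, 0)

lemma factors_arcAdj_step (hn : 3 ≤ n) (hN : N + 1 ≤ n)
    (h : Factors N Prod.snd (Reach (ArcAdj n (m + 1)) (center n))) :
    Factors N Prod.snd (Reach (ArcAdj n m) (center n)) :=
  h.descend hn hN (relabel n) (by simp [relabel, center, stIdx, lab_zero])
    fun _ _ huv => huv.subdivide hn

lemma continuous_seg_zero (n a : ℕ) : Continuous (seg n 0 a) := by
  refine Continuous.subtype_mk ?_ _
  simp only [interpC, vcoord_zero, if_true, embC]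
  fun_prop

lemma not_factors_arcAdj (hn : 3 ≤ n) (hN : N + 1 ≤ n) :
    ¬ Factors N Prod.snd (Reach (ArcAdj n m) (center n)) := by
  induction m with
  | zero =>
    refine not_factors_star hn hN (center n) (fun a => (vpt n a, a)) fun a h1 h2 =>
      ⟨⟨?_, .refl _⟩, rfl⟩
    have hx : XEdge n 0 a := (xEdge_iff hn).2 (Or.inl ⟨rfl, h1, h2⟩)
    exact ⟨hx, seg n 0 a, (continuous_seg_zero n a).continuousOn, seg_zero, hx.seg_one hn,
      fun _ _ => rfl⟩
  | succ m ih => exact fun h => ih (factors_arcAdj_step hn hN h)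

end pieces

section topology

variable {n l l' m : ℕ}

lemma vpt_injective (hn : 3 ≤ n) (hl : l ≤ n + 2) (hl' : l' ≤ n + 2)
    (h : vpt n l = vpt n l') : l = l' := by
  have h := embC_inj (n := n) (by omega) (congrArg Subtype.val h)
  unfold vcoord at h
  rw [Nat.mod_eq_of_lt (by split_ifs <;> (simp only; omega)),
    Nat.mod_eq_of_lt (by split_ifs <;> (simp only; omega))] at h
  split_ifs at h <;> norm_num at h <;> omega

/-- Interior points of edges of `X_0` are not vertices. -/
lemma XEdge.seg_ne_vpt (hn : 3 ≤ n) (h : XEdge n l l') {t : ℝ} (ht : t ∈ Ioo (0 : ℝ) 1) (k : ℕ) :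
    seg n l l' t ≠ vpt n k := by
  obtain ⟨a, k₀, k₁, hr, rfl, rfl⟩ := h
  obtain ⟨t0, t1⟩ := ht
  intro h
  have h := embC_inj (n := n) (by omega) (congrArg Subtype.val h)
  rw [interp_coord hn hr] at h
  have ha : 1 ≤ a ∧ a ≤ n := by unfold Rng at hr; omega
  have hx : ∃ x : ℝ, 0 < x ∧ x < 1 ∧ (x = 1 / 2 → a + 2 ≤ n) ∧
      x = if a + 2 ≤ n then t else if k₀ = 0 then t / 2 else (1 + t) / 2 := by
    refine ⟨_, ?_, ?_, ?_, rfl⟩ <;> split_ifs <;> intros <;> first | omega | linarith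
  obtain ⟨x, x0, x1, hx, e⟩ := hx
  rw [← e, max_eq_right x0.le, min_eq_right x1.le] at h
  simp only at h
  obtain ⟨h1, h2⟩ := h
  have h2 := h2.resolve_left x0.ne'
  unfold vcoord at h1 h2
  rw [Nat.mod_eq_of_lt (by omega),
    Nat.mod_eq_of_lt (by split_ifs <;> (simp only; omega))] at h2
  split_ifs at h1 h2 <;> norm_num at h1 <;> first | linarith | (have := hx (by linarith); omega)

/-- A path between two distinct vertices that avoids the vertices in between runs along an edge. -/
lemma adj_of_path {T : Type*} [TopologicalSpace T] [T2Space T] {Δ : GraphData T} (hΔ : Δ.IsGraph)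
    {c : ℝ → T} (hc : ContinuousOn c (Icc 0 1)) (h0 : c 0 ∈ Δ.verts) (h1 : c 1 ∈ Δ.verts)
    (hne : c 0 ≠ c 1) (hinside : ∀ t ∈ Ioo (0 : ℝ) 1, c t ∉ Δ.verts) : Δ.Adj (c 0) (c 1) := by
  obtain ⟨hcont, -, -, -, -, havoid, hcover, hmeet, -⟩ := hΔ
  set P : Fin Δ.nE → Set T := fun e => Δ.edge e '' Icc 0 1 with hP
  have hclosed : ∀ e, IsClosed (P e) := fun e =>
    (isCompact_Icc.image_of_continuousOn (hcont e)).isClosed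
  have hhalf : c (1 / 2) ∈ ⋃ e, P e := by rw [hcover]; trivial
  obtain ⟨e, he⟩ := mem_iUnion.1 hhalf
  have hpre : IsPreconnected (c '' Ioo 0 1) :=
    isPreconnected_Ioo.image _ (hc.mono Ioo_subset_Icc_self)
  have hdisj : c '' Ioo 0 1 ∩ (P e ∩ ⋃ e' ∈ {e' | e' ≠ e}, P e') = ∅ := by
    rw [eq_empty_iff_forall_notMem]
    rintro _ ⟨⟨t, ht, rfl⟩, hte, hte'⟩
    simp only [mem_iUnion] at hte'
    obtain ⟨e', hne', hte'⟩ := hte'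
    exact hinside t ht (hmeet e e' (Ne.symm hne') ⟨hte, hte'⟩)
  have hsub : c '' Ioo 0 1 ⊆ P e := by
    refine (isPreconnected_iff_subset_of_disjoint_closed.1 hpre (P e) (⋃ e' ∈ {e' | e' ≠ e}, P e')
      (hclosed e) ((toFinite _).isClosed_biUnion fun e' _ => hclosed e') ?_ hdisj).resolve_right ?_
    · intro x _
      have hx : x ∈ ⋃ e, P e := by rw [hcover]; trivial
      obtain ⟨e', he'⟩ := mem_iUnion.1 hx
      by_cases h : e' = e
      · exact Or.inl (h ▸ he')
      · exact Or.inr (mem_biUnion (show e' ∈ {e' | e' ≠ e} from h) he')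
    · intro h
      have hm : c (1 / 2) ∈ c '' Ioo 0 1 := ⟨1 / 2, by norm_num, rfl⟩
      exact eq_empty_iff_forall_notMem.1 hdisj _ ⟨hm, he, h hm⟩
  have hends : ∀ t ∈ Icc (0 : ℝ) 1, c t ∈ P e := by
    intro t ht
    have hcl : closure (Ioo (0 : ℝ) 1) = Icc 0 1 := closure_Ioo zero_ne_one
    have := ContinuousOn.image_closure (f := c) (s := Ioo 0 1) (by rwa [hcl])
    rw [hcl] at this
    exact (closure_minimal hsub (hclosed e)) (this ⟨t, ht, rfl⟩)
  have hvert : ∀ x ∈ Δ.verts, x ∈ P e → x = Δ.edge e 0 ∨ x = Δ.edge e 1 := by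
    rintro _ hx ⟨t, ht, rfl⟩
    rcases ht.1.eq_or_lt with rfl | h0
    · exact Or.inl rfl
    rcases ht.2.eq_or_lt with rfl | h1
    · exact Or.inr rfl
    exact absurd hx (havoid e t ⟨h0, h1⟩)
  refine ⟨e, ?_⟩
  rcases hvert _ h0 (hends 0 (by simp)) with e0 | e0 <;>
    rcases hvert _ h1 (hends 1 (by simp)) with e1 | e1
  · exact absurd (e0.trans e1.symm) hne
  · rw [e0, e1]
  · rw [e0, e1, pair_comm]
  · exact absurd (e0.trans e1.symm) hne

lemma mem_verts_X0graph (x : Sspace n) : x ∈ (X0graph n).verts ↔ ∃ l ≤ n + 2, vpt n l = x := by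
  simp [X0graph, Nat.lt_succ_iff]

lemma XEdge.le (hn : 3 ≤ n) (h : XEdge n l l') : l ≤ n + 2 ∧ l' ≤ n + 2 ∧ l ≠ l' := by
  rw [xEdge_iff hn] at h; omega

/-- A factorization of `f^m` through a simple-`N`-od graph yields a combinatorial one. -/
lemma factors_of_simpleOd (hn : 3 ≤ n) {N : ℕ} (hN : 1 ≤ N) {T : Type*} [TopologicalSpace T]
    [T2Space T] {Δ : GraphData T} {s₀ : T} (hT : IsSimpleOdGraphData Δ N s₀) {α : Sspace n → T}
    {β : T → Sspace n} (hα : Continuous α)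
    (hαv : ∀ x, (fS n)^[m] x ∈ (X0graph n).verts → α x ∈ Δ.verts)
    (hβv : ∀ s ∈ Δ.verts, β s ∈ (X0graph n).verts)
    (hfac : β ∘ α = (fS n)^[m]) (hβ₀ : β s₀ = vpt n 0) :
    Factors N Prod.snd (ArcAdj n m) := by
  classical
  obtain ⟨k, t, hΔ, -, ht0, hverts, hinj, hne, hadj⟩ := hT
  have hf : ∀ x, β (α x) = (fS n)^[m] x := fun x => congrFun hfac x
  have uniq : ∀ i j i' j', j ≤ k i → j' ≤ k i' → t i j = t i' j' → j = j' ∧ (j = 0 ∨ i = i') := by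
    intro i j i' j' h h' e
    rcases Nat.eq_zero_or_pos j with rfl | hj <;> rcases Nat.eq_zero_or_pos j' with rfl | hj'
    · simp
    · exact absurd (e.symm.trans (ht0 i)) (hne i' j' hj' h')
    · exact absurd (e.trans (ht0 i')) (hne i j hj h)
    · obtain ⟨h1, h2⟩ := hinj i j i' j' hj h hj' h' e
      exact ⟨h2, Or.inr h1⟩
  have hpos : ∀ u : Sspace n × ℕ, ∃ p : Fin N × ℕ,
      α u.1 ∈ Δ.verts → p.2 ≤ k p.1 ∧ t p.1 p.2 = α u.1 := by
    intro u
    by_cases hu : α u.1 ∈ (Δ.verts : Set T)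
    · rw [hverts] at hu
      rcases hu with hu | ⟨i, j, -, h, hu⟩
      · exact ⟨(⟨0, hN⟩, 0), fun _ => ⟨Nat.zero_le _, (ht0 _).trans hu.symm⟩⟩
      · exact ⟨(i, j), fun _ => ⟨h, hu.symm⟩⟩
    · exact ⟨(⟨0, hN⟩, 0), fun h => absurd h hu⟩
  choose A hA using hpos
  have hB : ∀ i j, ∃ b : ℕ, ∀ l ≤ n + 2, β (t i j) = vpt n l → b = l := by
    intro i j
    by_cases h : ∃ l ≤ n + 2, β (t i j) = vpt n l
    · obtain ⟨b, hb, e⟩ := h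
      exact ⟨b, fun l hl e' => vpt_injective hn hb hl (e.symm.trans e')⟩
    · exact ⟨0, fun l hl e' => absurd ⟨l, hl, e'⟩ h⟩
  choose B hB using hB
  refine ⟨B, A, fun i => hB i 0 0 (by omega) (by rw [ht0, hβ₀]), ?_⟩
  rintro u v ⟨hx, c, hc, c0, c1, hseg⟩
  obtain ⟨hu, hv, huv⟩ := hx.le hn
  have fu : (fS n)^[m] u.1 = vpt n u.2 := by rw [← c0, hseg 0 (by simp), seg_zero]
  have fv : (fS n)^[m] v.1 = vpt n v.2 := by rw [← c1, hseg 1 (by simp), hx.seg_one hn]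
  have au : α u.1 ∈ Δ.verts := hαv _ (by rw [fu, mem_verts_X0graph]; exact ⟨_, hu, rfl⟩)
  have av : α v.1 ∈ Δ.verts := hαv _ (by rw [fv, mem_verts_X0graph]; exact ⟨_, hv, rfl⟩)
  obtain ⟨ku, tu⟩ := hA u au
  obtain ⟨kv, tv⟩ := hA v av
  refine ⟨hB _ _ _ hu (by rw [tu, hf, fu]), hB _ _ _ hv (by rw [tv, hf, fv]), ?_⟩
  have hAdj : Δ.Adj (α u.1) (α v.1) := by
    have := adj_of_path (c := α ∘ c) hΔ (hα.comp_continuousOn hc) (by simpa [c0] using au)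
      (by simpa [c1] using av) ?_ ?_
    · simpa [c0, c1] using this
    · intro e
      simp only [Function.comp, c0, c1] at e
      refine huv (vpt_injective hn hu hv ?_)
      rw [← fu, ← fv, ← hf, ← hf, e]
    · intro s hs hmem
      have := hβv _ hmem
      rw [Function.comp, hf, hseg s (Ioo_subset_Icc_self hs), mem_verts_X0graph] at this
      obtain ⟨l, -, hl⟩ := this
      exact hx.seg_ne_vpt hn hs l hl.symm
  obtain ⟨i, j, hj, he⟩ := (hadj _ _).1 hAdj
  have key : ∀ p q : Fin N × ℕ, p.2 ≤ k p.1 → q.2 ≤ k q.1 → t p.1 p.2 = t i j →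
      t q.1 q.2 = t i (j + 1) → SAdj p q := by
    intro p q hp hq e1 e2
    obtain ⟨p2, p1⟩ := uniq _ _ _ _ hp (by omega) e1
    obtain ⟨q2, q1⟩ := uniq _ _ _ _ hq hj e2
    refine Or.inl ⟨by omega, ?_⟩
    rcases p1 with p1 | p1
    · exact Or.inl p1
    · exact Or.inr (p1.trans (q1.resolve_left (by omega)).symm)
  rcases pair_eq_pair_iff.1 he with ⟨e1, e2⟩ | ⟨e1, e2⟩
  · exact key _ _ ku kv (tu.trans e1) (tv.trans e2)
  · exact (key _ _ kv ku (tv.trans e2) (tu.trans e1)).symm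

end topology

end NOd

/-- Let `n ≥ 3`, `m ≥ 2`, let `X_m` be the subdivision of `S` with
vertex set `f^{-m}(V(X_0))` and `Φ_0^m = f^m`.  Given a simple-`n'`-od graph `T`
(`1 ≤ n' ≤ n - 1`) with branch point `s₀` and simplicial maps `α : X_m → T`
(surjective) and `β : T → X_0` with `β ∘ α = Φ_0^m`, `β s₀ = v_0`, there are
`1 ≤ n'₀ ≤ n'`, a simple-`n'₀`-od graph `T'` with branch point `s₀'`, and
simplicial maps `α' : X_m → T'`, `β' : T' → X_0` with `β' ∘ α' = Φ_0^m`,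
`β' s₀' = v_0`, such that whenever `x, y, z` are distinct vertices of `X_m` with
`x` adjacent to `y`, `y` adjacent to `z` and `α' y = s₀'`, then
`Φ_0^m x = v_{n-1}` or `Φ_0^m z = v_{n-1}`. -/
theorem statement14 (n : ℕ) (hn : 3 ≤ n) (m : ℕ) (hm : 2 ≤ m)
    (Γm : GraphData (Sspace n)) (hΓm : Γm.IsGraph)
    (hverts : (Γm.verts : Set (Sspace n)) = (fS n)^[m] ⁻¹' ((X0graph n).verts : Set (Sspace n)))
    (n' : ℕ) (h1 : 1 ≤ n') (h2 : n' ≤ n - 1)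
    (T : Type) [MetricSpace T] (Δ : GraphData T) (s₀ : T)
    (hT : IsSimpleOdGraphData Δ n' s₀)
    (α : Sspace n → T) (β : T → Sspace n)
    (hα : IsSimplicialMap Γm Δ α) (hαsurj : Function.Surjective α)
    (hβ : IsSimplicialMap Δ (X0graph n) β)
    (hfac : β ∘ α = (fS n)^[m]) (hβ₀ : β s₀ = vpt n 0) :
    ∃ n'₀ : ℕ, 1 ≤ n'₀ ∧ n'₀ ≤ n' ∧
      ∃ (T' : Type) (_ : MetricSpace T') (Δ' : GraphData T') (s₀' : T'),
        IsSimpleOdGraphData Δ' n'₀ s₀' ∧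
        ∃ (α' : Sspace n → T') (β' : T' → Sspace n),
          IsSimplicialMap Γm Δ' α' ∧ IsSimplicialMap Δ' (X0graph n) β' ∧
          β' ∘ α' = (fS n)^[m] ∧ β' s₀' = vpt n 0 ∧
          ∀ x y z : Sspace n, x ∈ Γm.verts → y ∈ Γm.verts → z ∈ Γm.verts →
            x ≠ y → y ≠ z → x ≠ z → Γm.Adj x y → Γm.Adj y z → α' y = s₀' →
            (fS n)^[m] x = vpt n (n - 1) ∨ (fS n)^[m] z = vpt n (n - 1) := by
  exfalso
  obtain ⟨B, A, hB, hA⟩ := NOd.factors_of_simpleOd (m := m) hn h1 hT hα.1 (fun x hx => hα.2.1 x (by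
    rw [← Finset.mem_coe, hverts]; exact hx)) hβ.2.1 hfac hβ₀
  exact NOd.not_factors_arcAdj hn (by omega) ⟨B, A, hB, fun u v h => hA u v h.1⟩
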